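/- arXiv:2507.13770 — 2 statements merged into one kernel-verified Lean document; each statement's English description precedes it below -/
import Mathlib

section
/- Let η > 0, r ∈ ℕ, and let X be a C^∞ vector field on [0,1] vanishing exactly at 0 and 1 and with DX(0) = DX(1) = 0. Then there exists λ_X > 1 such that for every λ ≥ λ_X there exists φ ∈ Diff^∞_+([0,1]) with: (1) ‖φ_*X‖_r < η; (2) φ(x) = λx on a neighborhood of 0 and φ(x) = 1 − λ(1−x) on a neighborhood of 1. -/
open Filter Set

noncomputable section

/-- An element of `Diff^n_+([0,1])`. -/
structure DiffIcc (n : ℕ∞) where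
  toFun : ℝ → ℝ
  invFun : ℝ → ℝ
  smooth : ContDiffOn ℝ n toFun (Set.Icc 0 1)
  smooth_inv : ContDiffOn ℝ n invFun (Set.Icc 0 1)
  maps : Set.MapsTo toFun (Set.Icc 0 1) (Set.Icc 0 1)
  maps_inv : Set.MapsTo invFun (Set.Icc 0 1) (Set.Icc 0 1)
  left_inv : ∀ x ∈ Set.Icc (0:ℝ) 1, invFun (toFun x) = x
  right_inv : ∀ x ∈ Set.Icc (0:ℝ) 1, toFun (invFun x) = x
  fix0 : toFun 0 = 0
  fix1 : toFun 1 = 1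
  deriv_pos : ∀ x ∈ Set.Icc (0:ℝ) 1, 0 < derivWithin toFun (Set.Icc 0 1) x

/-- The push-forward `φ_*X = (Dφ · X)∘φ⁻¹` of a vector field `X` on `[0,1]` by a
diffeomorphism `φ` of `[0,1]`. -/
def pushforward (φ : DiffIcc ⊤) (X : ℝ → ℝ) : ℝ → ℝ :=
  fun x => derivWithin φ.toFun (Set.Icc 0 1) (φ.invFun x) * X (φ.invFun x)

theorem iteratedDerivWithin_comp_affine {𝕜 F : Type*} [NontriviallyNormedField 𝕜]
    [NormedAddCommGroup F] [NormedSpace 𝕜 F] {f : 𝕜 → F} {s : Set 𝕜} (hs : UniqueDiffOn 𝕜 s)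
    {n : ℕ} (hf : ContDiffOn 𝕜 n f s) (c d : 𝕜) (hmaps : MapsTo (fun x => c * x + d) s s)
    {x : 𝕜} (hx : x ∈ s) :
    iteratedDerivWithin n (fun x => f (c * x + d)) s x
      = c ^ n • iteratedDerivWithin n f s (c * x + d) := by
  induction n generalizing x with
  | zero => simp
  | succ n ih =>
    have hcx : c * x + d ∈ s := hmaps hx
    have h₁ : DifferentiableWithinAt 𝕜 (iteratedDerivWithin n f s) s (c * x + d) :=
      hf.differentiableOn_iteratedDerivWithin (Nat.cast_lt.mpr n.lt_succ_self) hs _ hcx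
    have hd : HasDerivWithinAt (fun x => c * x + d) c s x := by
      simpa using ((hasDerivWithinAt_id x s).const_mul c).add_const d
    have h₂ := (h₁.hasDerivWithinAt.scomp x hd hmaps).const_smul (c ^ n)
    rw [iteratedDerivWithin_succ, derivWithin_congr (fun y hy => ih hf.of_succ hy) (ih hf.of_succ hx),
      iteratedDerivWithin_succ]
    refine (h₂.derivWithin (hs x hx)).trans ?_
    rw [smul_smul, pow_succ]

/-- The `k`-th derivatives of a function which is smooth on `[0,1]` are bounded, uniformly for
`k ≤ r`. -/
theorem exists_bound_iteratedDerivWithin_Icc {f : ℝ → ℝ}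
    (hf : ContDiffOn ℝ (⊤ : ℕ∞) f (Icc 0 1)) (r : ℕ) :
    ∃ M > 0, ∀ k ≤ r, ∀ x ∈ Icc (0:ℝ) 1, |iteratedDerivWithin k f (Icc 0 1) x| ≤ M := by
  have h : ∀ k : ℕ, ∃ M, ∀ x ∈ Icc (0:ℝ) 1, |iteratedDerivWithin k f (Icc 0 1) x| ≤ M := by
    intro k
    have hc := hf.continuousOn_iteratedDerivWithin (m := k) (by exact_mod_cast le_top)
      (uniqueDiffOn_Icc zero_lt_one)
    obtain ⟨M, hM⟩ := isCompact_Icc.exists_bound_of_continuousOn hc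
    exact ⟨M, hM⟩
  choose M hM using h
  refine ⟨1 + ∑ k ∈ Finset.range (r + 1), |M k|, by positivity, fun k hk x hx => ?_⟩
  have h1 : |M k| ≤ ∑ k ∈ Finset.range (r + 1), |M k| :=
    Finset.single_le_sum (f := fun k => |M k|) (fun _ _ => abs_nonneg _)
      (Finset.mem_range.2 (by omega))
  linarith [hM k x hx, le_abs_self (M k)]

theorem add_sub_div_mem_Icc {q lam y : ℝ} (hq : q ∈ Icc (0:ℝ) 1) (hlam : 1 ≤ lam)
    (hy : y ∈ Icc (0:ℝ) 1) : q + (y - q) / lam ∈ Icc (0:ℝ) 1 := by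
  have h := (convex_Icc (0:ℝ) 1).add_smul_sub_mem hq hy
    (t := lam⁻¹) ⟨by positivity, inv_le_one_of_one_le₀ hlam⟩
  simpa [div_eq_inv_mul] using h

theorem contDiffOn_blowup {X : ℝ → ℝ} (hX : ContDiffOn ℝ (⊤ : ℕ∞) X (Icc 0 1))
    {q lam : ℝ} (hq : q ∈ Icc (0:ℝ) 1) (hlam : 1 ≤ lam) :
    ContDiffOn ℝ (⊤ : ℕ∞) (fun y => lam * X (q + (y - q) / lam)) (Icc 0 1) := by
  refine contDiffOn_const.mul (hX.comp ?_ fun y hy => add_sub_div_mem_Icc hq hlam hy)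
  fun_prop

/-- Blowing up a vector field at a zero with vanishing derivative makes it `C^r`-small. -/
theorem eventually_blowup_small {X : ℝ → ℝ} (hX : ContDiffOn ℝ (⊤ : ℕ∞) X (Icc 0 1))
    {q : ℝ} (hq : q ∈ Icc (0:ℝ) 1) (hXq : X q = 0) (hDq : derivWithin X (Icc 0 1) q = 0)
    (r : ℕ) {ε : ℝ} (hε : 0 < ε) :
    ∀ᶠ lam : ℝ in atTop, ∀ k ≤ r, ∀ y ∈ Icc (0:ℝ) 1,
      |iteratedDerivWithin k (fun y => lam * X (q + (y - q) / lam)) (Icc 0 1) y| < ε := by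
  have hu : UniqueDiffOn ℝ (Icc (0:ℝ) 1) := uniqueDiffOn_Icc zero_lt_one
  obtain ⟨M, hM0, hM⟩ := exists_bound_iteratedDerivWithin_Icc hX r
  have hformula : ∀ lam : ℝ, 1 ≤ lam → ∀ k : ℕ, ∀ y ∈ Icc (0:ℝ) 1,
      iteratedDerivWithin k (fun y => lam * X (q + (y - q) / lam)) (Icc 0 1) y
        = lam * (lam⁻¹ ^ k * iteratedDerivWithin k X (Icc 0 1) (q + (y - q) / lam)) := by
    intro lam hlam k y hy
    have e : ∀ y : ℝ, q + (y - q) / lam = lam⁻¹ * y + (q - lam⁻¹ * q) := fun y => by ring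
    have hm : MapsTo (fun y => lam⁻¹ * y + (q - lam⁻¹ * q)) (Icc (0:ℝ) 1) (Icc 0 1) := by
      intro y hy
      simpa only [← e] using add_sub_div_mem_Icc hq hlam hy
    simp only [e]
    rw [iteratedDerivWithin_const_mul_field,
      iteratedDerivWithin_comp_affine hu (hX.of_le (by exact_mod_cast le_top)) _ _ hm hy,
      smul_eq_mul]
  have h0 : ∀ᶠ x in nhdsWithin q (Icc 0 1), |X x| ≤ ε / 2 * |x - q| := by
    have hd : HasDerivWithinAt X 0 (Icc 0 1) q := by
      simpa only [hDq] using ((hX.differentiableOn (by simp)) q hq).hasDerivWithinAt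
    have := (hasDerivWithinAt_iff_isLittleO.1 hd).bound (half_pos hε)
    simpa [hXq] using this
  have h1 : ∀ᶠ x in nhdsWithin q (Icc 0 1), |iteratedDerivWithin 1 X (Icc 0 1) x| < ε := by
    have hc := hX.continuousOn_iteratedDerivWithin (m := 1) (by exact_mod_cast le_top) hu q hq
    have : iteratedDerivWithin 1 X (Icc 0 1) q = 0 := by
      rw [iteratedDerivWithin_one]; exact hDq
    have h2 := hc.abs
    rw [ContinuousWithinAt, this, abs_zero] at h2
    exact h2.eventually_lt_const hε
  obtain ⟨δ, hδ, hδX⟩ := 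
    Metric.eventually_nhds_iff.1 (eventually_nhdsWithin_iff.1 (h0.and h1))
  filter_upwards [eventually_ge_atTop 1, eventually_gt_atTop (1 / δ), eventually_gt_atTop (M / ε)]
    with lam hl1 hl2 hl3 k hk y hy
  have hl0 : 0 < lam := by linarith
  rw [hformula lam hl1 k y hy]
  have hz := add_sub_div_mem_Icc hq hl1 hy
  have hzk := hM k hk _ hz
  have hyq : |y - q| ≤ 1 := by
    rw [abs_le]; constructor <;> linarith [hy.1, hy.2, hq.1, hq.2]
  set z := q + (y - q) / lam with hzdef
  have hzq : |z - q| = |y - q| / lam := by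
    rw [hzdef, add_sub_cancel_left, abs_div, abs_of_pos hl0]
  have hzδ : |z - q| < δ := by
    rw [hzq, div_lt_iff₀ hl0]
    rw [div_lt_iff₀ hδ] at hl2
    linarith
  obtain ⟨hz0, hz1⟩ := hδX (y := z) hzδ hz
  rcases k with _ | _ | k
  · simp only [pow_zero, one_mul, iteratedDerivWithin_zero, abs_mul, abs_of_pos hl0]
    calc lam * |X z| ≤ lam * (ε / 2 * |z - q|) := by gcongr
      _ = ε / 2 * |y - q| := by rw [hzq]; field_simp
      _ < ε := by nlinarith
  · simpa [hl0.ne'] using hz1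
  · rw [abs_mul, abs_mul, abs_of_pos hl0, abs_of_pos (by positivity)]
    have hp : lam * lam⁻¹ ^ (k + 1 + 1) ≤ lam⁻¹ := by
      have h1 : lam⁻¹ ^ k ≤ 1 := pow_le_one₀ (by positivity) (inv_le_one_of_one_le₀ hl1)
      calc lam * lam⁻¹ ^ (k + 1 + 1) = lam⁻¹ ^ k * lam⁻¹ := by
            rw [pow_succ, pow_succ]; field_simp
        _ ≤ 1 * lam⁻¹ := by gcongr
        _ = lam⁻¹ := one_mul _
    calc lam * (lam⁻¹ ^ (k + 1 + 1) * |iteratedDerivWithin (k + 1 + 1) X (Icc 0 1) z|)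
        = lam * lam⁻¹ ^ (k + 1 + 1) * |iteratedDerivWithin (k + 1 + 1) X (Icc 0 1) z| := by ring
      _ ≤ lam⁻¹ * M := by gcongr
      _ < ε := by
        rw [inv_mul_eq_div, div_lt_iff₀ hl0]
        rw [div_lt_iff₀ hε] at hl3
        linarith

/-- A smooth cutoff of a blown-up vector field is still `C^r`-small. -/
theorem eventually_cutoff_blowup_small {X χ : ℝ → ℝ}
    (hX : ContDiffOn ℝ (⊤ : ℕ∞) X (Icc 0 1)) (hχ : ContDiff ℝ (⊤ : ℕ∞) χ)
    {q : ℝ} (hq : q ∈ Icc (0:ℝ) 1) (hXq : X q = 0) (hDq : derivWithin X (Icc 0 1) q = 0)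
    (r : ℕ) {ε : ℝ} (hε : 0 < ε) :
    ∀ᶠ lam : ℝ in atTop, ∀ k ≤ r, ∀ y ∈ Icc (0:ℝ) 1,
      |iteratedDerivWithin k (fun y => χ y * (lam * X (q + (y - q) / lam))) (Icc 0 1) y| < ε := by
  have hu : UniqueDiffOn ℝ (Icc (0:ℝ) 1) := uniqueDiffOn_Icc zero_lt_one
  obtain ⟨M, hM0, hM⟩ := exists_bound_iteratedDerivWithin_Icc hχ.contDiffOn r
  have hC : 0 < 2 ^ r * M := by positivity
  filter_upwards [eventually_ge_atTop 1,
    eventually_blowup_small hX hq hXq hDq r (ε := ε / (2 * (2 ^ r * M))) (by positivity)]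
    with lam hlam hsmall k hk y hy
  have hmul := iteratedDerivWithin_mul (n := k) hy hu
    ((hχ.of_le (by exact_mod_cast le_top)).contDiffWithinAt)
    (((contDiffOn_blowup hX hq hlam) y hy).of_le (by exact_mod_cast le_top))
  rw [show (fun y => χ y * (lam * X (q + (y - q) / lam)))
    = χ * fun y => lam * X (q + (y - q) / lam) from rfl, hmul]
  refine (Finset.abs_sum_le_sum_abs _ _).trans_lt ?_
  calc _ ≤ ∑ i ∈ Finset.range (k + 1), (k.choose i : ℝ) * (M * (ε / (2 * (2 ^ r * M)))) := by
        refine Finset.sum_le_sum fun i hi => ?_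
        rw [Finset.mem_range] at hi
        rw [abs_mul, abs_mul, Nat.abs_cast, mul_assoc]
        have h1 := hM i (by omega) y hy
        have h2 := (hsmall (k - i) (by omega) y hy).le
        gcongr
    _ = 2 ^ k * (M * (ε / (2 * (2 ^ r * M)))) := by
        rw [← Finset.sum_mul]
        congr 1
        exact_mod_cast Nat.sum_range_choose k
    _ ≤ 2 ^ r * (M * (ε / (2 * (2 ^ r * M)))) := by
        gcongr
        norm_num
    _ = ε / 2 := by field_simp
    _ < ε := half_lt_self hε

/-- A vector field on `[0,1]` that is positive on `(0,1)` agrees on `[a, 1 - a]` with a bounded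
positive smooth vector field on the line. -/
theorem exists_positive_extension {X : ℝ → ℝ} (hX : ContDiffOn ℝ (⊤ : ℕ∞) X (Icc 0 1))
    (hpos : ∀ x ∈ Ioo (0:ℝ) 1, 0 < X x) {a : ℝ} (ha : 0 < a) :
    ∃ (Z : ℝ → ℝ) (M : ℝ), ContDiff ℝ (⊤ : ℕ∞) Z ∧ (∀ x, 0 < Z x) ∧ (∀ x, Z x ≤ M) ∧
      ∀ x ∈ Icc a (1 - a), Z x = X x := by
  obtain ⟨M, hM⟩ := isCompact_Icc.exists_bound_of_continuousOn hX.continuousOn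
  set θ : ℝ → ℝ := fun x =>
    Real.smoothTransition (2 * x / a - 1) * Real.smoothTransition (2 * (1 - x) / a - 1) with hθ
  have hθs : ContDiff ℝ (⊤ : ℕ∞) θ := by
    refine (Real.smoothTransition.contDiff.comp ?_).mul (Real.smoothTransition.contDiff.comp ?_)
    · fun_prop
    · fun_prop
  have hθ0 : ∀ x, 0 ≤ θ x := fun x =>
    mul_nonneg (Real.smoothTransition.nonneg _) (Real.smoothTransition.nonneg _)
  have hθ1 : ∀ x, θ x ≤ 1 := fun x =>
    mul_le_one₀ (Real.smoothTransition.le_one _) (Real.smoothTransition.nonneg _)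
      (Real.smoothTransition.le_one _)
  have hl : ∀ x < a / 2, θ x = 0 := by
    intro x hx
    have : 2 * x / a - 1 ≤ 0 := by
      rw [sub_nonpos, div_le_one ha]; linarith
    simp only [hθ, Real.smoothTransition.zero_of_nonpos this, zero_mul]
  have hr : ∀ x > 1 - a / 2, θ x = 0 := by
    intro x hx
    have : 2 * (1 - x) / a - 1 ≤ 0 := by
      rw [sub_nonpos, div_le_one ha]; linarith
    simp only [hθ, Real.smoothTransition.zero_of_nonpos this, mul_zero]
  have hout : ∀ x ∉ Ioo (0:ℝ) 1, θ =ᶠ[nhds x] 0 := by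
    intro x hx
    rcases le_or_gt x 0 with h | h
    · filter_upwards [Iio_mem_nhds (show x < a / 2 by linarith)] with y hy using hl y hy
    · have h1 : 1 ≤ x := not_lt.1 fun h1 => hx ⟨h, h1⟩
      filter_upwards [Ioi_mem_nhds (show 1 - a / 2 < x by linarith)] with y hy using hr y hy
  refine ⟨fun x => θ x * X x + (1 - θ x), |M| + 1, ?_, ?_, ?_, ?_⟩
  · refine ContDiff.add ?_ (contDiff_const.sub hθs)
    rw [contDiff_iff_contDiffAt]
    intro x
    by_cases hx : x ∈ Ioo (0:ℝ) 1
    · exact hθs.contDiffAt.mul (hX.contDiffAt (Icc_mem_nhds hx.1 hx.2))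
    · refine (contDiffAt_const (c := (0:ℝ))).congr_of_eventuallyEq ?_
      filter_upwards [hout x hx] with y hy
      simp [hy]
  · intro x
    by_cases hx : x ∈ Ioo (0:ℝ) 1
    · have h1 := hpos x hx
      rcases (hθ0 x).eq_or_lt with h | h
      · simp [← h]
      · nlinarith [mul_pos h h1, hθ1 x]
    · simp [(hout x hx).eq_of_nhds]
  · intro x
    by_cases hx : x ∈ Ioo (0:ℝ) 1
    · have h1 : X x ≤ |M| :=
        ((le_abs_self _).trans (hM x (Ioo_subset_Icc_self hx))).trans (le_abs_self M)
      nlinarith [hθ0 x, hθ1 x, abs_nonneg M, mul_le_mul_of_nonneg_left h1 (hθ0 x)]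
    · simp [(hout x hx).eq_of_nhds]
  · intro x hx
    have h1 : θ x = 1 := by
      have e1 : 1 ≤ 2 * x / a - 1 := by
        rw [le_sub_iff_add_le, le_div_iff₀ ha]; linarith [hx.1]
      have e2 : 1 ≤ 2 * (1 - x) / a - 1 := by
        rw [le_sub_iff_add_le, le_div_iff₀ ha]; linarith [hx.2]
      simp only [hθ, Real.smoothTransition.one_of_one_le e1,
        Real.smoothTransition.one_of_one_le e2, mul_one]
    simp [h1]

/-- The primitive of a smooth function bounded below by a positive constant is a smooth
diffeomorphism of the line. -/
theorem exists_smooth_inverse_primitive {f : ℝ → ℝ} (hf : ContDiff ℝ (⊤ : ℕ∞) f) {m : ℝ}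
    (hm : 0 < m) (hfm : ∀ x, m ≤ f x) (a : ℝ) :
    ∃ E : ℝ → ℝ, ContDiff ℝ (⊤ : ℕ∞) E ∧ (∀ x, E (∫ t in a..x, f t) = x) ∧
      (∀ y, ∫ t in a..E y, f t = y) := by
  set F : ℝ → ℝ := fun x => ∫ t in a..x, f t with hF
  have hd : ∀ x, HasDerivAt F (f x) x := fun x =>
    (hf.continuous.integral_hasStrictDerivAt a x).hasDerivAt
  have hFs : ContDiff ℝ (⊤ : ℕ∞) F := by
    rw [contDiff_infty_iff_deriv]
    refine ⟨fun x => (hd x).differentiableAt, ?_⟩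
    rwa [show deriv F = f from funext fun x => (hd x).deriv]
  have hpos : ∀ x, 0 < f x := fun x => hm.trans_le (hfm x)
  have hmono : StrictMono F := strictMono_of_hasDerivAt_pos hd hpos
  have hge : ∀ x y, x ≤ y → m * (y - x) ≤ F y - F x := by
    intro x y hxy
    exact Convex.mul_sub_le_image_sub_of_le_deriv (D := univ) convex_univ
      hFs.continuous.continuousOn (fun x _ => (hd x).differentiableAt.differentiableWithinAt)
      (fun x _ => by rw [(hd x).deriv]; exact hfm x) x (mem_univ _) y (mem_univ _) hxy
  have ha : F a = 0 := intervalIntegral.integral_same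
  have hsurj : Function.Surjective F := by
    refine hFs.continuous.surjective ?_ ?_
    · refine tendsto_atTop_mono' _ ?_
        ((tendsto_atTop_add_const_right _ (-a) tendsto_id).const_mul_atTop hm)
      filter_upwards [eventually_ge_atTop a] with x hx
      simpa [ha, sub_eq_add_neg] using hge a x hx
    · refine tendsto_atBot_mono' _ ?_
        ((tendsto_atBot_add_const_right _ (-a) tendsto_id).const_mul_atBot hm)
      filter_upwards [eventually_le_atBot a] with x hx
      have := hge x a hx
      simp only [ha, id] at this ⊢
      linarith
  let e := (hmono.orderIsoOfSurjective F hsurj).toHomeomorph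
  have he : (e : ℝ → ℝ) = F := rfl
  refine ⟨e.symm, e.contDiff_symm_deriv (f' := f) (fun x => (hpos x).ne') (by rwa [he])
    (by rwa [he]), fun x => ?_, fun y => ?_⟩
  · exact e.symm_apply_apply x
  · exact e.apply_symm_apply y

/-- Two positive densities on the line that correspond to each other under homotheties of ratio
`lam` near the endpoints, and have the same mass in between, are conjugate by a diffeomorphism of
`[0,1]` which is a homothety of ratio `lam` near the endpoints. -/
theorem exists_diffIcc_of_densities {f g : ℝ → ℝ} (hf : ContDiff ℝ (⊤ : ℕ∞) f)
    (hg : ContDiff ℝ (⊤ : ℕ∞) g) {mf mg : ℝ} (hmf : 0 < mf) (hmg : 0 < mg)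
    (hfm : ∀ x, mf ≤ f x) (hgm : ∀ x, mg ≤ g x) {lam p : ℝ} (hp : 0 ≤ p)
    (h0 : ∀ x ≤ p, lam * g (lam * x) = f x)
    (h1 : ∀ x ≥ 1 - p, lam * g (lam * x + (1 - lam)) = f x)
    (hT : ∫ t in lam * p..1 - lam * p, g t = ∫ t in p..1 - p, f t) :
    ∃ φ : DiffIcc ⊤, StrictMono φ.toFun ∧ (∀ x ≤ p, φ.toFun x = lam * x) ∧
      (∀ x ≥ 1 - p, φ.toFun x = 1 - lam * (1 - x)) ∧
      ∀ x ∈ Icc (0:ℝ) 1, derivWithin φ.toFun (Icc 0 1) x = f x / g (φ.toFun x) := by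
  obtain ⟨EF, hEFs, hEF1, hEF2⟩ := exists_smooth_inverse_primitive hf hmf hfm p
  obtain ⟨EG, hEGs, hEG1, hEG2⟩ := exists_smooth_inverse_primitive hg hmg hgm (lam * p)
  have hdF : ∀ x, HasDerivAt (fun x => ∫ t in p..x, f t) (f x) x := fun x =>
    (hf.continuous.integral_hasStrictDerivAt p x).hasDerivAt
  have hdG : ∀ x, HasDerivAt (fun x => ∫ t in lam * p..x, g t) (g x) x := fun x =>
    (hg.continuous.integral_hasStrictDerivAt (lam * p) x).hasDerivAt
  have smooth_of : ∀ {u U : ℝ → ℝ}, ContDiff ℝ (⊤ : ℕ∞) u → (∀ x, HasDerivAt U (u x) x) →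
      ContDiff ℝ (⊤ : ℕ∞) U := by
    intro u U hu hU
    rw [contDiff_infty_iff_deriv]
    exact ⟨fun x => (hU x).differentiableAt, by rwa [show deriv U = u from funext fun x => (hU x).deriv]⟩
  have hfpos : ∀ x, 0 < f x := fun x => hmf.trans_le (hfm x)
  have hgpos : ∀ x, 0 < g x := fun x => hmg.trans_le (hgm x)
  set φ : ℝ → ℝ := fun x => EG (∫ t in p..x, f t) with hφ
  set ψ : ℝ → ℝ := fun y => EF (∫ t in lam * p..y, g t) with hψ
  have hφs : ContDiff ℝ (⊤ : ℕ∞) φ := hEGs.comp (smooth_of hf hdF)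
  have hψs : ContDiff ℝ (⊤ : ℕ∞) ψ := hEFs.comp (smooth_of hg hdG)
  have hGφ : ∀ x, ∫ t in lam * p..φ x, g t = ∫ t in p..x, f t := fun x => hEG2 _
  have hFψ : ∀ x, ∫ t in p..ψ x, f t = ∫ t in lam * p..x, g t := fun x => hEF2 _
  have hψφ : ∀ x, ψ (φ x) = x := fun x => by rw [hψ]; simp only [hGφ, hEF1]
  have hφψ : ∀ x, φ (ψ x) = x := fun x => by rw [hφ]; simp only [hFψ, hEG1]
  have hφd : ∀ x, HasDerivAt φ (f x / g (φ x)) x := by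
    intro x
    have hd := (hφs.differentiable (by simp) x).hasDerivAt
    have h2 : HasDerivAt (fun x => ∫ t in p..x, f t) (g (φ x) * deriv φ x) x := by
      have := (hdG (φ x)).comp x hd
      rwa [show (fun x => ∫ t in lam * p..x, g t) ∘ φ = fun x => ∫ t in p..x, f t from
        funext hGφ] at this
    rwa [(hdF x).unique h2, mul_div_cancel_left₀ _ (hgpos _).ne']
  have hmono : StrictMono φ :=
    strictMono_of_hasDerivAt_pos hφd fun x => div_pos (hfpos x) (hgpos _)
  have hleft : ∀ x ≤ p, φ x = lam * x := by
    intro x hx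
    have : ∫ t in p..x, f t = ∫ t in lam * p..lam * x, g t := by
      rw [← intervalIntegral.mul_integral_comp_mul_left, ← intervalIntegral.integral_const_mul]
      refine intervalIntegral.integral_congr fun t ht => ?_
      rw [uIcc_of_ge hx] at ht
      exact (h0 t ht.2).symm
    rw [hφ]
    simp only [this, hEG1]
  have hright : ∀ x ≥ 1 - p, φ x = 1 - lam * (1 - x) := by
    intro x hx
    have h2 : ∫ t in 1 - p..x, f t = ∫ t in 1 - lam * p..1 - lam * (1 - x), g t := by
      rw [show 1 - lam * p = lam * (1 - p) + (1 - lam) by ring,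
        show 1 - lam * (1 - x) = lam * x + (1 - lam) by ring,
        ← intervalIntegral.mul_integral_comp_mul_add, ← intervalIntegral.integral_const_mul]
      refine intervalIntegral.integral_congr fun t ht => ?_
      rw [uIcc_of_le hx] at ht
      exact (h1 t ht.1).symm
    have h3 : ∫ t in p..x, f t = ∫ t in lam * p..1 - lam * (1 - x), g t := by
      rw [← intervalIntegral.integral_add_adjacent_intervals
          (hf.continuous.intervalIntegrable p (1 - p)) (hf.continuous.intervalIntegrable _ _),
        ← intervalIntegral.integral_add_adjacent_intervals
          (hg.continuous.intervalIntegrable _ (1 - lam * p)) (hg.continuous.intervalIntegrable _ _),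
        hT, h2]
    rw [hφ]
    simp only [h3, hEG1]
  have hφ0 : φ 0 = 0 := by simpa using hleft 0 hp
  have hφ1 : φ 1 = 1 := by simpa using hright 1 (by linarith)
  have hderiv : ∀ x ∈ Icc (0:ℝ) 1, derivWithin φ (Icc 0 1) x = f x / g (φ x) := fun x hx =>
    (hφd x).hasDerivWithinAt.derivWithin (uniqueDiffOn_Icc zero_lt_one x hx)
  refine ⟨⟨φ, ψ, hφs.contDiffOn, hψs.contDiffOn, ?_, ?_, fun x _ => hψφ x, fun x _ => hφψ x,
    hφ0, hφ1, fun x hx => ?_⟩, hmono, hleft, hright, hderiv⟩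
  · intro x hx
    exact ⟨hφ0 ▸ hmono.monotone hx.1, hφ1 ▸ hmono.monotone hx.2⟩
  · intro y hy
    constructor
    · rw [← hmono.le_iff_le, hφψ, hφ0]; exact hy.1
    · rw [← hmono.le_iff_le, hφψ, hφ1]; exact hy.2
  · rw [hderiv x hx]
    exact div_pos (hfpos x) (hgpos _)

/-- The time needed to cross `[1/8, 7/8]` along `A + c ρ` can be prescribed by choosing `c`. -/
theorem exists_crossing_time_eq {A ρ : ℝ → ℝ} (hA : Continuous A) (hρ : Continuous ρ)
    (hpos : ∀ c > 0, ∀ y, 0 < A y + c * ρ y)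
    (hA0 : ∀ y ∈ Icc (3 / 8 : ℝ) (5 / 8), A y = 0)
    (hρ1 : ∀ y ∈ Icc (3 / 8 : ℝ) (5 / 8), ρ y = 1)
    {T c₀ : ℝ} (hT : 0 < T) (hc₀ : 0 < c₀)
    (hle : ∫ y in (1 / 8 : ℝ)..7 / 8, (A y + c₀ * ρ y)⁻¹ ≤ T) :
    ∃ c, 0 < c ∧ c ≤ c₀ ∧ ∫ y in (1 / 8 : ℝ)..7 / 8, (A y + c * ρ y)⁻¹ = T := by
  set c₁ := min c₀ (1 / (4 * T)) with hc₁
  have hc₁0 : 0 < c₁ := lt_min hc₀ (by positivity)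
  have hmax : ∀ c, 0 < max c c₁ := fun c => lt_max_of_lt_right hc₁0
  have hcont : Continuous fun c : ℝ => ∫ y in (1 / 8 : ℝ)..7 / 8, (A y + max c c₁ * ρ y)⁻¹ := by
    refine intervalIntegral.continuous_parametric_intervalIntegral_of_continuous' ?_ _ _
    refine Continuous.inv₀ ?_ fun q => (hpos _ (hmax q.1) q.2).ne'
    fun_prop
  have hge : T ≤ ∫ y in (1 / 8 : ℝ)..7 / 8, (A y + c₁ * ρ y)⁻¹ := by
    have hc : Continuous fun y => (A y + c₁ * ρ y)⁻¹ :=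
      Continuous.inv₀ (by fun_prop) fun y => (hpos _ hc₁0 y).ne'
    have h1 : ∫ y in (3 / 8 : ℝ)..5 / 8, (A y + c₁ * ρ y)⁻¹ = 1 / 4 * c₁⁻¹ := by
      rw [intervalIntegral.integral_congr (g := fun _ => c₁⁻¹)]
      · rw [intervalIntegral.integral_const, smul_eq_mul]; norm_num
      · intro y hy
        rw [uIcc_of_le (by norm_num)] at hy
        simp [hA0 y hy, hρ1 y hy]
    have h2 : T ≤ 1 / 4 * c₁⁻¹ := by
      have h3 : c₁ ≤ 1 / (4 * T) := min_le_right _ _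
      rw [le_div_iff₀ (by positivity)] at h3
      rw [← div_eq_mul_inv, le_div_iff₀ hc₁0]
      linarith
    refine h2.trans (h1.symm.le.trans ?_)
    exact intervalIntegral.integral_mono_interval (by norm_num) (by norm_num) (by norm_num)
      (Eventually.of_forall fun y => (inv_pos.2 (hpos _ hc₁0 y)).le) (hc.intervalIntegrable _ _)
  have hle' : c₁ ≤ c₀ := min_le_left _ _
  obtain ⟨c, hc, hcT⟩ := intermediate_value_Icc' hle' hcont.continuousOn
    (show T ∈ Icc _ _ from ⟨by simpa [max_eq_left hle'] using hle, by simpa using hge⟩)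
  refine ⟨c, hc₁0.trans_le hc.1, hc.2, ?_⟩
  simpa [max_eq_left hc.1] using hcT

/-- A smooth cutoff equal to `1` on `(-∞, 1/4]` and to `0` on `[3/8, ∞)`. -/
def leftCutoff (y : ℝ) : ℝ := Real.smoothTransition (3 - 8 * y)

/-- A smooth cutoff equal to `0` on `(-∞, 5/8]` and to `1` on `[3/4, ∞)`. -/
def rightCutoff (y : ℝ) : ℝ := Real.smoothTransition (8 * y - 5)

/-- A smooth bump equal to `1` on `[1/4, 3/4]` and to `0` outside `(1/8, 7/8)`. -/
def middleBump (y : ℝ) : ℝ :=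
  Real.smoothTransition (8 * y - 1) * Real.smoothTransition (7 - 8 * y)

theorem leftCutoff_contDiff : ContDiff ℝ (⊤ : ℕ∞) leftCutoff :=
  Real.smoothTransition.contDiff.comp (by fun_prop)

theorem rightCutoff_contDiff : ContDiff ℝ (⊤ : ℕ∞) rightCutoff :=
  Real.smoothTransition.contDiff.comp (by fun_prop)

theorem middleBump_contDiff : ContDiff ℝ (⊤ : ℕ∞) middleBump :=
  (Real.smoothTransition.contDiff.comp (by fun_prop)).mul
    (Real.smoothTransition.contDiff.comp (by fun_prop))

theorem leftCutoff_nonneg (y : ℝ) : 0 ≤ leftCutoff y := Real.smoothTransition.nonneg _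

theorem rightCutoff_nonneg (y : ℝ) : 0 ≤ rightCutoff y := Real.smoothTransition.nonneg _

theorem middleBump_nonneg (y : ℝ) : 0 ≤ middleBump y :=
  mul_nonneg (Real.smoothTransition.nonneg _) (Real.smoothTransition.nonneg _)

theorem leftCutoff_le_one (y : ℝ) : leftCutoff y ≤ 1 := Real.smoothTransition.le_one _

theorem rightCutoff_le_one (y : ℝ) : rightCutoff y ≤ 1 := Real.smoothTransition.le_one _

theorem middleBump_le_one (y : ℝ) : middleBump y ≤ 1 :=
  mul_le_one₀ (Real.smoothTransition.le_one _) (Real.smoothTransition.nonneg _)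
    (Real.smoothTransition.le_one _)

theorem leftCutoff_eq_one {y : ℝ} (hy : y ≤ 1 / 4) : leftCutoff y = 1 :=
  Real.smoothTransition.one_of_one_le (by linarith)

theorem leftCutoff_eq_zero {y : ℝ} (hy : 3 / 8 ≤ y) : leftCutoff y = 0 :=
  Real.smoothTransition.zero_of_nonpos (by linarith)

theorem rightCutoff_eq_one {y : ℝ} (hy : 3 / 4 ≤ y) : rightCutoff y = 1 :=
  Real.smoothTransition.one_of_one_le (by linarith)

theorem rightCutoff_eq_zero {y : ℝ} (hy : y ≤ 5 / 8) : rightCutoff y = 0 :=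
  Real.smoothTransition.zero_of_nonpos (by linarith)

theorem middleBump_eq_one {y : ℝ} (h1 : 1 / 4 ≤ y) (h2 : y ≤ 3 / 4) : middleBump y = 1 := by
  rw [middleBump, Real.smoothTransition.one_of_one_le (by linarith),
    Real.smoothTransition.one_of_one_le (by linarith), one_mul]

theorem middleBump_eq_zero_of_le {y : ℝ} (hy : y ≤ 1 / 8) : middleBump y = 0 := by
  rw [middleBump, Real.smoothTransition.zero_of_nonpos (by linarith), zero_mul]

theorem middleBump_eq_zero_of_ge {y : ℝ} (hy : 7 / 8 ≤ y) : middleBump y = 0 := by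
  rw [middleBump, Real.smoothTransition.zero_of_nonpos (x := 7 - 8 * y) (by linarith), mul_zero]

/-- The vector field obtained by gluing the blow-ups of `X` at both endpoints. -/
def gluedBlowup (X : ℝ → ℝ) (lam y : ℝ) : ℝ :=
  leftCutoff y * (lam * X (0 + (y - 0) / lam)) + rightCutoff y * (lam * X (1 + (y - 1) / lam))

theorem gluedBlowup_of_le {X : ℝ → ℝ} {lam y : ℝ} (hy : y ≤ 1 / 4) :
    gluedBlowup X lam y = lam * X (y / lam) := by
  rw [gluedBlowup, leftCutoff_eq_one hy, rightCutoff_eq_zero (by linarith)]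
  simp

theorem gluedBlowup_of_ge {X : ℝ → ℝ} {lam y : ℝ} (hy : 3 / 4 ≤ y) :
    gluedBlowup X lam y = lam * X (1 + (y - 1) / lam) := by
  rw [gluedBlowup, rightCutoff_eq_one hy, leftCutoff_eq_zero (by linarith)]
  simp

theorem gluedBlowup_contDiff {Z : ℝ → ℝ} (hZ : ContDiff ℝ (⊤ : ℕ∞) Z) (lam : ℝ) :
    ContDiff ℝ (⊤ : ℕ∞) (gluedBlowup Z lam) := by
  refine (leftCutoff_contDiff.mul (contDiff_const.mul (hZ.comp ?_))).add
    (rightCutoff_contDiff.mul (contDiff_const.mul (hZ.comp ?_))) <;> fun_prop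

theorem gluedBlowup_nonneg {Z : ℝ → ℝ} (hZ : ∀ x, 0 < Z x) {lam : ℝ} (hlam : 0 < lam) (y : ℝ) :
    0 ≤ gluedBlowup Z lam y :=
  add_nonneg (mul_nonneg (leftCutoff_nonneg y) (mul_nonneg hlam.le (hZ _).le))
    (mul_nonneg (rightCutoff_nonneg y) (mul_nonneg hlam.le (hZ _).le))

theorem gluedBlowup_add_bump_pos {Z : ℝ → ℝ} (hZ : ∀ x, 0 < Z x) {lam : ℝ} (hlam : 0 < lam)
    {c : ℝ} (hc : 0 < c) (y : ℝ) : 0 < gluedBlowup Z lam y + c * middleBump y := by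
  have hb : 0 ≤ c * middleBump y := mul_nonneg hc.le (middleBump_nonneg y)
  rcases le_total y (1 / 4) with h | h
  · rw [gluedBlowup_of_le h]
    linarith [mul_pos hlam (hZ (y / lam))]
  rcases le_total y (3 / 4) with h' | h'
  · rw [middleBump_eq_one h h']
    linarith [gluedBlowup_nonneg hZ hlam y]
  · rw [gluedBlowup_of_ge h']
    linarith [mul_pos hlam (hZ (1 + (y - 1) / lam))]

/-- If the blow-up of `X` is bounded by `c₀`, crossing `[1/8, 7/8]` along the glued blow-up plus
`c₀` times the bump is at least as fast as crossing the corresponding interval along `X`. -/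
theorem crossing_time_le {X Z : ℝ → ℝ} (hZs : Continuous Z) (hZ : ∀ x, 0 < Z x)
    {lam : ℝ} (hlam : 1 ≤ lam)
    (hZX : ∀ x ∈ Icc (1 / (8 * lam)) (1 - 1 / (8 * lam)), Z x = X x) {c₀ : ℝ} (hc₀ : 0 < c₀)
    (hsmall : ∀ y ∈ Icc (0:ℝ) 1, lam * X (y / lam) ≤ c₀)
    (hcont : Continuous (gluedBlowup Z lam)) :
    ∫ y in (1 / 8 : ℝ)..7 / 8, (gluedBlowup Z lam y + c₀ * middleBump y)⁻¹
      ≤ ∫ x in 1 / (8 * lam)..1 - 1 / (8 * lam), (Z x)⁻¹ := by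
  have hl0 : 0 < lam := by linarith
  have hpos := gluedBlowup_add_bump_pos hZ hl0 hc₀
  have hYc : Continuous fun y => (gluedBlowup Z lam y + c₀ * middleBump y)⁻¹ :=
    Continuous.inv₀ (hcont.add (continuous_const.mul middleBump_contDiff.continuous))
      fun y => (hpos y).ne'
  have hZc : Continuous fun x => (Z x)⁻¹ := hZs.inv₀ fun x => (hZ x).ne'
  have hmem : ∀ y : ℝ, 1 / 8 ≤ y → y ≤ 7 / 8 →
      y / lam ∈ Icc (1 / (8 * lam)) (1 - 1 / (8 * lam)) := by
    intro y h1 h2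
    constructor
    · rw [div_le_div_iff₀ (by positivity) hl0]; nlinarith
    · rw [le_sub_iff_add_le, show y / lam + 1 / (8 * lam) = (y + 1 / 8) / lam by field_simp,
        div_le_one hl0]
      linarith
  have hL : ∫ y in (1 / 8 : ℝ)..3 / 4, (gluedBlowup Z lam y + c₀ * middleBump y)⁻¹
      ≤ ∫ x in 1 / (8 * lam)..3 / (4 * lam), (Z x)⁻¹ := by
    have e : ∫ x in 1 / (8 * lam)..3 / (4 * lam), (Z x)⁻¹
        = ∫ y in (1 / 8 : ℝ)..3 / 4, lam⁻¹ * (Z (y / lam))⁻¹ := by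
      rw [intervalIntegral.integral_const_mul,
        intervalIntegral.inv_mul_integral_comp_div (f := fun x => (Z x)⁻¹), div_div, div_div]
    rw [e]
    refine intervalIntegral.integral_mono_on (by norm_num) (hYc.intervalIntegrable _ _)
      ((continuous_const.mul (hZc.comp (by fun_prop))).intervalIntegrable _ _) fun y hy => ?_
    rw [← mul_inv]
    refine inv_anti₀ (mul_pos hl0 (hZ _)) ?_
    rcases le_total y (1 / 4) with h | h
    · rw [gluedBlowup_of_le h]
      exact le_add_of_nonneg_right (mul_nonneg hc₀.le (middleBump_nonneg y))
    · rw [middleBump_eq_one h hy.2, hZX _ (hmem y hy.1 (by linarith [hy.2]))]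
      linarith [hsmall y ⟨by linarith, by linarith [hy.2]⟩, gluedBlowup_nonneg hZ hl0 y]
  have hR : ∫ y in (3 / 4 : ℝ)..7 / 8, (gluedBlowup Z lam y + c₀ * middleBump y)⁻¹
      ≤ ∫ x in 1 - 1 / (4 * lam)..1 - 1 / (8 * lam), (Z x)⁻¹ := by
    have e : ∫ x in 1 - 1 / (4 * lam)..1 - 1 / (8 * lam), (Z x)⁻¹
        = ∫ y in (3 / 4 : ℝ)..7 / 8, lam⁻¹ * (Z (1 - 1 / lam + y / lam))⁻¹ := by
      rw [intervalIntegral.integral_const_mul,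
        intervalIntegral.inv_mul_integral_comp_add_div (f := fun x => (Z x)⁻¹)]
      congr 1 <;> field_simp <;> ring
    rw [e]
    refine intervalIntegral.integral_mono_on (by norm_num) (hYc.intervalIntegrable _ _)
      ((continuous_const.mul (hZc.comp (by fun_prop))).intervalIntegrable _ _) fun y hy => ?_
    rw [← mul_inv, show 1 - 1 / lam + y / lam = 1 + (y - 1) / lam by ring]
    refine inv_anti₀ (mul_pos hl0 (hZ _)) ?_
    rw [gluedBlowup_of_ge hy.1]
    exact le_add_of_nonneg_right (mul_nonneg hc₀.le (middleBump_nonneg y))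
  have hM : 0 ≤ ∫ x in 3 / (4 * lam)..1 - 1 / (4 * lam), (Z x)⁻¹ := by
    refine intervalIntegral.integral_nonneg ?_ fun x _ => (inv_pos.2 (hZ x)).le
    rw [le_sub_iff_add_le, ← add_div, div_le_one (by positivity)]
    linarith
  have hi : ∀ a b, IntervalIntegrable (fun x => (Z x)⁻¹) MeasureTheory.volume a b :=
    fun a b => hZc.intervalIntegrable a b
  rw [← intervalIntegral.integral_add_adjacent_intervals (hYc.intervalIntegrable _ (3 / 4))
      (hYc.intervalIntegrable _ _),
    ← intervalIntegral.integral_add_adjacent_intervals (hi _ (3 / (4 * lam))) (hi _ _),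
    ← intervalIntegral.integral_add_adjacent_intervals (hi (3 / (4 * lam)) (1 - 1 / (4 * lam)))
      (hi _ _)]
  linarith

/-- A positive vector field can be pushed forward to its glued blow-up plus a small multiple of
the bump, by a diffeomorphism that is a homothety near each endpoint. -/
theorem exists_diffIcc_pushforward_eq {X : ℝ → ℝ} (hX : ContDiffOn ℝ (⊤ : ℕ∞) X (Icc 0 1))
    (hpos : ∀ x ∈ Ioo (0:ℝ) 1, 0 < X x) {lam : ℝ} (hlam : 1 ≤ lam) {c₀ : ℝ} (hc₀ : 0 < c₀)
    (hsmall : ∀ y ∈ Icc (0:ℝ) 1, lam * X (y / lam) ≤ c₀) :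
    ∃ c, 0 < c ∧ c ≤ c₀ ∧ ∃ φ : DiffIcc ⊤,
      EqOn (pushforward φ X) (fun y => gluedBlowup X lam y + c * middleBump y) (Icc 0 1) ∧
      (∃ δ > (0 : ℝ), ∀ x ∈ Icc 0 δ, φ.toFun x = lam * x) ∧
      (∃ δ > (0 : ℝ), ∀ x ∈ Icc (1 - δ) 1, φ.toFun x = 1 - lam * (1 - x)) := by
  have hl0 : 0 < lam := by linarith
  set p := 1 / (8 * lam) with hp
  have hp0 : 0 < p := by positivity
  have hlp : lam * p = 1 / 8 := by rw [hp]; field_simp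
  have hp8 : p ≤ 1 / 8 := by nlinarith
  obtain ⟨Z, M, hZs, hZ, hZM, hZX⟩ := exists_positive_extension hX hpos hp0
  have hM : 0 < M := (hZ 0).trans_le (hZM 0)
  have hAs := gluedBlowup_contDiff hZs lam
  have hApos := fun (c : ℝ) (hc : 0 < c) => gluedBlowup_add_bump_pos hZ hl0 hc
  have hZinv : Continuous fun x => (Z x)⁻¹ := hZs.continuous.inv₀ fun x => (hZ x).ne'
  obtain ⟨c, hc, hcc₀, hcT⟩ := exists_crossing_time_eq hAs.continuous
    middleBump_contDiff.continuous hApos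
    (fun y hy => by rw [gluedBlowup, leftCutoff_eq_zero hy.1, rightCutoff_eq_zero hy.2]; simp)
    (fun y hy => middleBump_eq_one (by linarith [hy.1]) (by linarith [hy.2]))
    (T := ∫ x in p..1 - p, (Z x)⁻¹)
    (intervalIntegral.intervalIntegral_pos_of_pos (hZinv.intervalIntegrable _ _)
      (fun x => inv_pos.2 (hZ x)) (by linarith))
    hc₀ (crossing_time_le hZs.continuous hZ hlam hZX hc₀ hsmall hAs.continuous)
  set Y : ℝ → ℝ := fun y => gluedBlowup Z lam y + c * middleBump y with hY
  have hYs : ContDiff ℝ (⊤ : ℕ∞) Y := hAs.add (contDiff_const.mul middleBump_contDiff)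
  have hYM : ∀ y, Y y ≤ lam * M + lam * M + c := by
    intro y
    have h1 : ∀ x, lam * Z x ≤ lam * M := fun x => mul_le_mul_of_nonneg_left (hZM x) hl0.le
    have h2 : ∀ x, 0 ≤ lam * Z x := fun x => (mul_pos hl0 (hZ x)).le
    refine add_le_add (add_le_add ?_ ?_) ?_
    · exact (mul_le_of_le_one_left (h2 _) (leftCutoff_le_one y)).trans (h1 _)
    · exact (mul_le_of_le_one_left (h2 _) (rightCutoff_le_one y)).trans (h1 _)
    · exact mul_le_of_le_one_right hc.le (middleBump_le_one y)
  have hYle : ∀ y ≤ 1 / 8, Y y = lam * Z (y / lam) := fun y hy => by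
    simp [hY, gluedBlowup_of_le (show y ≤ 1 / 4 by linarith), middleBump_eq_zero_of_le hy]
  have hYge : ∀ y ≥ 7 / 8, Y y = lam * Z (1 + (y - 1) / lam) := fun y hy => by
    simp [hY, gluedBlowup_of_ge (show 3 / 4 ≤ y by linarith), middleBump_eq_zero_of_ge hy]
  obtain ⟨φ, hφm, hφl, hφr, hφd⟩ := exists_diffIcc_of_densities
    (f := fun x => (Z x)⁻¹) (g := fun y => (Y y)⁻¹)
    (hZs.inv fun x => (hZ x).ne') (hYs.inv fun y => (hApos c hc y).ne')
    (inv_pos.2 hM) (inv_pos.2 (show 0 < lam * M + lam * M + c by positivity))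
    (fun x => inv_anti₀ (hZ x) (hZM x)) (fun y => inv_anti₀ (hApos c hc y) (hYM y)) hp0.le
    (lam := lam)
    (fun x hx => by
      rw [hYle _ (by nlinarith), mul_div_cancel_left₀ _ hl0.ne', mul_inv,
        mul_inv_cancel_left₀ hl0.ne'])
    (fun x hx => by
      rw [hYge _ (by nlinarith), show 1 + (lam * x + (1 - lam) - 1) / lam = x by field_simp; ring,
        mul_inv, mul_inv_cancel_left₀ hl0.ne'])
    (by rw [hlp, show (1:ℝ) - 1 / 8 = 7 / 8 by norm_num]; exact hcT)
  refine ⟨c, hc, hcc₀, φ, fun y hy => ?_, ⟨p, hp0, fun x hx => hφl x hx.2⟩,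
    ⟨p, hp0, fun x hx => hφr x hx.1⟩⟩
  have hx := φ.maps_inv hy
  have hxy := φ.right_inv y hy
  have hd := hφd _ hx
  simp only [pushforward]
  rw [hd, hxy]
  set x := φ.invFun y
  rw [inv_div_inv]
  rcases lt_or_ge x p with h | h
  · have hy' : y = lam * x := by rw [← hxy, hφl x h.le]
    have hy8 : y ≤ 1 / 8 := by rw [hy', ← hlp]; gcongr
    rw [hYle y hy8, gluedBlowup_of_le (by linarith), middleBump_eq_zero_of_le hy8,
      hy', mul_div_cancel_left₀ _ hl0.ne']
    field_simp [(hZ x).ne']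
    ring
  rcases lt_or_ge (1 - p) x with h' | h'
  · have hy' : y = 1 - lam * (1 - x) := by rw [← hxy, hφr x h'.le]
    have hy8 : 7 / 8 ≤ y := by rw [hy']; nlinarith
    have e : 1 + (y - 1) / lam = x := by rw [hy']; field_simp; ring
    rw [hYge y hy8, gluedBlowup_of_ge (by linarith), middleBump_eq_zero_of_ge hy8, e]
    field_simp [(hZ x).ne']
    ring
  · have hxZ := hZX x ⟨h, h'⟩
    have hy1 : 1 / 8 ≤ y := by
      have := hφm.monotone h
      rwa [hφl p le_rfl, hlp, hxy] at this
    have hy2 : y ≤ 7 / 8 := by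
      have := hφm.monotone h'
      rw [hφr _ le_rfl, hxy] at this
      linarith
    rw [← hxZ, div_mul_cancel₀ _ (hZ x).ne']
    simp only [hY, gluedBlowup]
    congr 2
    · rcases le_total y (3 / 8) with h3 | h3
      · rw [hZX]
        rw [zero_add, sub_zero]
        constructor
        · rw [hp, le_div_iff₀ hl0]; linarith
        · rw [div_le_iff₀ hl0]; linarith
      · simp [leftCutoff_eq_zero h3]
    · rcases le_total y (5 / 8) with h3 | h3
      · simp [rightCutoff_eq_zero h3]
      · rw [hZX]
        have e : 1 + (y - 1) / lam = (lam + y - 1) / lam := by field_simp; ring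
        rw [e]
        constructor
        · rw [le_div_iff₀ hl0]; linarith
        · rw [div_le_iff₀ hl0]; linarith

theorem eventually_exists_pushforward_small_of_pos {X : ℝ → ℝ}
    (hX : ContDiffOn ℝ (⊤ : ℕ∞) X (Icc 0 1)) (hpos : ∀ x ∈ Ioo (0:ℝ) 1, 0 < X x)
    (hX0 : X 0 = 0) (hX1 : X 1 = 0) (hD0 : derivWithin X (Icc 0 1) 0 = 0)
    (hD1 : derivWithin X (Icc 0 1) 1 = 0) (r : ℕ) {η : ℝ} (hη : 0 < η) :
    ∀ᶠ lam : ℝ in atTop, ∃ φ : DiffIcc ⊤,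
      (∀ k ≤ r, ∀ x ∈ Icc (0:ℝ) 1,
        |iteratedDerivWithin k (pushforward φ X) (Icc 0 1) x| < η) ∧
      (∃ δ > (0 : ℝ), ∀ x ∈ Icc 0 δ, φ.toFun x = lam * x) ∧
      (∃ δ > (0 : ℝ), ∀ x ∈ Icc (1 - δ) 1, φ.toFun x = 1 - lam * (1 - x)) := by
  have hu : UniqueDiffOn ℝ (Icc (0:ℝ) 1) := uniqueDiffOn_Icc zero_lt_one
  have h0 : (0:ℝ) ∈ Icc (0:ℝ) 1 := left_mem_Icc.2 zero_le_one
  have h1 : (1:ℝ) ∈ Icc (0:ℝ) 1 := right_mem_Icc.2 zero_le_one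
  obtain ⟨R, hR, hRb⟩ := exists_bound_iteratedDerivWithin_Icc middleBump_contDiff.contDiffOn r
  have hc₀ : 0 < η / (3 * R) := by positivity
  filter_upwards [eventually_ge_atTop 1, eventually_blowup_small hX h0 hX0 hD0 0 hc₀,
    eventually_cutoff_blowup_small hX leftCutoff_contDiff h0 hX0 hD0 r (ε := η / 3) (by positivity),
    eventually_cutoff_blowup_small hX rightCutoff_contDiff h1 hX1 hD1 r (ε := η / 3) (by positivity)]
    with lam hlam hB hL hRt
  obtain ⟨c, hc, hcc, φ, hφ, hφ0, hφ1⟩ := exists_diffIcc_pushforward_eq hX hpos hlam hc₀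
    (fun y hy => by
      have := (le_abs_self _).trans (hB 0 le_rfl y hy).le
      simpa using this)
  refine ⟨φ, fun k hk y hy => ?_, hφ0, hφ1⟩
  have hk' : (k : WithTop ℕ∞) ≤ ((⊤ : ℕ∞) : WithTop ℕ∞) := by exact_mod_cast le_top
  have hLs : ContDiffWithinAt ℝ k
      (fun y => leftCutoff y * (lam * X (0 + (y - 0) / lam))) (Icc 0 1) y :=
    ((leftCutoff_contDiff.contDiffOn.mul (contDiffOn_blowup hX h0 hlam)) y hy).of_le hk'
  have hRs : ContDiffWithinAt ℝ k
      (fun y => rightCutoff y * (lam * X (1 + (y - 1) / lam))) (Icc 0 1) y :=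
    ((rightCutoff_contDiff.contDiffOn.mul (contDiffOn_blowup hX h1 hlam)) y hy).of_le hk'
  have hMs : ContDiffWithinAt ℝ k (fun y => c * middleBump y) (Icc 0 1) y :=
    (contDiff_const.mul middleBump_contDiff).contDiffWithinAt.of_le hk'
  rw [iteratedDerivWithin_congr hφ hy]
  simp only [gluedBlowup]
  rw [iteratedDerivWithin_fun_add hy hu (hLs.add hRs) hMs,
    iteratedDerivWithin_fun_add hy hu hLs hRs, iteratedDerivWithin_const_mul_field]
  have hm : |c * iteratedDerivWithin k middleBump (Icc 0 1) y| ≤ η / 3 := by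
    rw [abs_mul, abs_of_pos hc]
    calc _ ≤ η / (3 * R) * R := by
          have := hRb k hk y hy
          gcongr
      _ = η / 3 := by field_simp
  refine (abs_add_three _ _ _).trans_lt ?_
  linarith [hL k hk y hy, hRt k hk y hy]

theorem pushforward_neg (φ : DiffIcc ⊤) (X : ℝ → ℝ) :
    pushforward φ (-X) = -pushforward φ X := by
  ext x
  simp [pushforward]

theorem pos_or_neg_of_ne_zero {X : ℝ → ℝ} (hX : ContinuousOn X (Icc 0 1))
    (hne : ∀ x ∈ Ioo (0:ℝ) 1, X x ≠ 0) :
    (∀ x ∈ Ioo (0:ℝ) 1, 0 < X x) ∨ ∀ x ∈ Ioo (0:ℝ) 1, X x < 0 := by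
  by_contra! h
  obtain ⟨⟨x, hx, hx0⟩, ⟨y, hy, hy0⟩⟩ := h
  obtain ⟨z, hz, hz0⟩ := isPreconnected_Ioo.intermediate_value hx hy
    (hX.mono Ioo_subset_Icc_self) ⟨hx0, hy0⟩
  exact hne z hz hz0

/-- A smooth vector field on `[0,1]` vanishing only at the endpoints, with vanishing
derivative there, can be pushed forward to an arbitrarily `C^r`-small vector field by a
diffeomorphism which is a homothety of any prescribed (sufficiently large) ratio `λ`
near each endpoint. -/
theorem pushforward_small_with_homotheties (η : ℝ) (hη : 0 < η) (r : ℕ) (X : ℝ → ℝ)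
    (hX : ContDiffOn ℝ (⊤ : ℕ∞) X (Set.Icc 0 1))
    (hzero : ∀ x ∈ Set.Icc (0:ℝ) 1, (X x = 0 ↔ x = 0 ∨ x = 1))
    (hD0 : derivWithin X (Set.Icc 0 1) 0 = 0)
    (hD1 : derivWithin X (Set.Icc 0 1) 1 = 0) :
    ∃ lX : ℝ, 1 < lX ∧ ∀ lam ≥ lX, ∃ φ : DiffIcc ⊤,
      (∀ k ≤ r, ∀ x ∈ Set.Icc (0:ℝ) 1,
        |iteratedDerivWithin k (pushforward φ X) (Set.Icc 0 1) x| < η) ∧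
      (∃ δ > (0 : ℝ), ∀ x ∈ Set.Icc 0 δ, φ.toFun x = lam * x) ∧
      (∃ δ > (0 : ℝ), ∀ x ∈ Set.Icc (1 - δ) 1, φ.toFun x = 1 - lam * (1 - x)) := by
  have h0 : X 0 = 0 := (hzero 0 (by simp)).2 (Or.inl rfl)
  have h1 : X 1 = 0 := (hzero 1 (by simp)).2 (Or.inr rfl)
  have hne : ∀ x ∈ Ioo (0:ℝ) 1, X x ≠ 0 := fun x hx hx0 => by
    rcases (hzero x (Ioo_subset_Icc_self hx)).1 hx0 with h | h
    · exact hx.1.ne' h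
    · exact hx.2.ne h
  obtain ⟨L, hL⟩ : ∃ L : ℝ, ∀ lam ≥ L, ∃ φ : DiffIcc ⊤,
      (∀ k ≤ r, ∀ x ∈ Set.Icc (0:ℝ) 1,
        |iteratedDerivWithin k (pushforward φ X) (Set.Icc 0 1) x| < η) ∧
      (∃ δ > (0 : ℝ), ∀ x ∈ Set.Icc 0 δ, φ.toFun x = lam * x) ∧
      (∃ δ > (0 : ℝ), ∀ x ∈ Set.Icc (1 - δ) 1, φ.toFun x = 1 - lam * (1 - x)) := by
    rw [← eventually_atTop]
    rcases pos_or_neg_of_ne_zero hX.continuousOn hne with hpos | hneg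
    · exact eventually_exists_pushforward_small_of_pos hX hpos h0 h1 hD0 hD1 r hη
    · have h := eventually_exists_pushforward_small_of_pos hX.neg
        (fun x hx => neg_pos.2 (hneg x hx)) (by simp [h0]) (by simp [h1])
        (by rw [derivWithin.fun_neg, hD0, neg_zero]) (by rw [derivWithin.fun_neg, hD1, neg_zero])
        r hη
      filter_upwards [h] with lam ⟨φ, hφ, hφ01⟩
      refine ⟨φ, fun k hk x hx => ?_, hφ01⟩
      have h2 := hφ k hk x hx
      rwa [show (fun x => -X x) = -X from rfl, pushforward_neg, iteratedDerivWithin_neg,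
        abs_neg] at h2
  exact ⟨max L 2, by simp, fun lam hlam => hL lam ((le_max_left _ _).trans hlam)⟩
end
end

section
/- Let X and Z be C^1 vector fields on [0,1] vanishing exactly at 0 and 1, whose time-1 maps f = φ_X^1 and g = φ_Z^1 are C^∞ diffeomorphisms of [0,1]. Assume there exist orientation-preserving C^1 diffeomorphisms φ₀ (between one-sided neighborhoods of 0 in [0,1], with φ₀(0) = 0) and φ₁ (between one-sided neighborhoods of 1 in [0,1], with φ₁(1) = 1) such that φ₀∘f = g∘φ₀ near 0 and φ₁∘f = g∘φ₁ near 1. Then there is a unique C^1 diffeomorphism φ of [0,1] coinciding with φ₀ on a neighborhood of 0 and satisfying φ∘f = g∘φ on [0,1]; moreover φ is C^∞ on (0,1), and there is a real number σ such that φ = φ₁∘φ_X^σ on a neighborhood of 1, where for any x₀ sufficiently close to 0 and x₁ sufficiently close to 1, σ = ∫_{x₀}^{x₁} dx/X(x) − ∫_{φ₀(x₀)}^{φ₁(x₁)} dx/Z(x). -/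
open Filter Set MeasureTheory

noncomputable section

open Topology
open scoped ContDiff

/-- The function `u` is bounded and has `k` continuous bounded derivatives on `ℝ`. -/
def BddDeriv : ℕ → (ℝ → ℝ) → Prop
  | 0, u => Continuous u ∧ ∃ C, ∀ t, |u t| ≤ C
  | k + 1, u => (∃ C, ∀ t, |u t| ≤ C) ∧
      ∃ u' : ℝ → ℝ, (∀ t, HasDerivAt u (u' t) t) ∧ BddDeriv k u'

namespace BddDeriv

variable {k : ℕ} {u u₁ u₂ : ℝ → ℝ}

lemma bounded (h : BddDeriv k u) : ∃ C, ∀ t, |u t| ≤ C := by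
  cases k with
  | zero => exact h.2
  | succ k => exact h.1

lemma contDiff (h : BddDeriv k u) : ContDiff ℝ k u := by
  induction k generalizing u with
  | zero => exact contDiff_zero.2 h.1
  | succ k ih =>
    obtain ⟨-, u', hu, hu'⟩ := h
    have : deriv u = u' := funext fun t => (hu t).deriv
    have h1 : ContDiff ℝ ((k : WithTop ℕ∞) + 1) u := by
      rw [contDiff_succ_iff_deriv]
      exact ⟨fun t => (hu t).differentiableAt, by simp, this ▸ ih hu'⟩
    exact_mod_cast h1

lemma continuous (h : BddDeriv k u) : Continuous u := h.contDiff.continuous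

lemma of_succ (h : BddDeriv (k + 1) u) : BddDeriv k u := by
  induction k generalizing u with
  | zero => exact ⟨h.continuous, h.bounded⟩
  | succ k ih =>
    obtain ⟨hb, u', hu, hu'⟩ := h
    exact ⟨hb, u', hu, ih hu'⟩

lemma const (c : ℝ) : BddDeriv k fun _ => c := by
  induction k generalizing c with
  | zero => exact ⟨continuous_const, |c|, fun _ => le_rfl⟩
  | succ k ih => exact ⟨⟨|c|, fun _ => le_rfl⟩, fun _ => 0, fun t => hasDerivAt_const t c, ih 0⟩

lemma add (h₁ : BddDeriv k u₁) (h₂ : BddDeriv k u₂) : BddDeriv k fun t => u₁ t + u₂ t := by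
  induction k generalizing u₁ u₂ with
  | zero =>
    obtain ⟨C₁, hC₁⟩ := h₁.2
    obtain ⟨C₂, hC₂⟩ := h₂.2
    exact ⟨h₁.1.add h₂.1, C₁ + C₂, fun t => (abs_add_le _ _).trans (add_le_add (hC₁ t) (hC₂ t))⟩
  | succ k ih =>
    obtain ⟨⟨C₁, hC₁⟩, v₁, hv₁, hk₁⟩ := h₁
    obtain ⟨⟨C₂, hC₂⟩, v₂, hv₂, hk₂⟩ := h₂
    exact ⟨⟨C₁ + C₂, fun t => (abs_add_le _ _).trans (add_le_add (hC₁ t) (hC₂ t))⟩,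
      _, fun t => (hv₁ t).add (hv₂ t), ih hk₁ hk₂⟩

lemma of_le {j : ℕ} (h : BddDeriv k u) (hjk : j ≤ k) : BddDeriv j u := by
  induction hjk with
  | refl => exact h
  | step _ ih => exact ih h.of_succ

lemma bounded_mul (h₁ : BddDeriv k u₁) (h₂ : BddDeriv k u₂) : ∃ C, ∀ t, |u₁ t * u₂ t| ≤ C := by
  obtain ⟨C₁, hC₁⟩ := h₁.bounded
  obtain ⟨C₂, hC₂⟩ := h₂.bounded
  refine ⟨C₁ * C₂, fun t => ?_⟩
  rw [abs_mul]
  exact mul_le_mul (hC₁ t) (hC₂ t) (abs_nonneg _) ((abs_nonneg _).trans (hC₁ t))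

lemma mul (h₁ : BddDeriv k u₁) (h₂ : BddDeriv k u₂) : BddDeriv k fun t => u₁ t * u₂ t := by
  induction k generalizing u₁ u₂ with
  | zero => exact ⟨h₁.1.mul h₂.1, h₁.bounded_mul h₂⟩
  | succ k ih =>
    have hb := h₁.bounded_mul h₂
    have h₁' := h₁.of_succ
    have h₂' := h₂.of_succ
    obtain ⟨-, v₁, hv₁, hk₁⟩ := h₁
    obtain ⟨-, v₂, hv₂, hk₂⟩ := h₂
    exact ⟨hb, _, fun t => (hv₁ t).mul (hv₂ t), (ih hk₁ h₂').add (ih h₁' hk₂)⟩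

end BddDeriv

/-- `T` is an integral curve in `(0,1)` with positive velocity `v`, and `w` is the logarithmic
derivative of `v`. -/
structure IntegralCurve (T v w : ℝ → ℝ) : Prop where
  mem : ∀ t, T t ∈ Ioo (0 : ℝ) 1
  deriv_T : ∀ t, HasDerivAt T (v t) t
  pos : ∀ t, 0 < v t
  deriv_v : ∀ t, HasDerivAt v (w t * v t) t
  cont_w : Continuous w
  bdd_w : ∃ M, ∀ t, |w t| ≤ M

namespace IntegralCurve

variable {T v w : ℝ → ℝ}

lemma velocity_add (h : IntegralCurve T v w) (t s : ℝ) :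
    ∃ ξ ∈ uIcc t (t + s), v (t + s) = Real.exp (s * w ξ) * v t := by
  have hlog : ∀ t, HasDerivAt (fun t => Real.log (v t)) (w t) t := fun t => by
    have := (h.deriv_v t).log (h.pos t).ne'
    rwa [mul_div_cancel_right₀ _ (h.pos t).ne'] at this
  have hc : Continuous fun t => Real.log (v t) :=
    continuous_iff_continuousAt.2 fun t => (hlog t).continuousAt
  suffices hs : ∃ ξ ∈ uIcc t (t + s), Real.log (v (t + s)) - Real.log (v t) = s * w ξ by
    obtain ⟨ξ, hξ, he⟩ := hs
    refine ⟨ξ, hξ, ?_⟩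
    rw [← he, Real.exp_sub, Real.exp_log (h.pos _), Real.exp_log (h.pos _),
      div_mul_cancel₀ _ (h.pos t).ne']
  rcases lt_trichotomy s 0 with hs | rfl | hs
  · obtain ⟨ξ, hξ, he⟩ := exists_hasDerivAt_eq_slope _ _ (show t + s < t by linarith)
      hc.continuousOn fun x _ => hlog x
    refine ⟨ξ, by rw [uIcc_of_ge (by linarith)]; exact Ioo_subset_Icc_self hξ, ?_⟩
    rw [he]
    field_simp [hs.ne]
    ring
  · exact ⟨t, by simp, by simp⟩
  · obtain ⟨ξ, hξ, he⟩ := exists_hasDerivAt_eq_slope _ _ (show t < t + s by linarith)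
      hc.continuousOn fun x _ => hlog x
    refine ⟨ξ, by rw [uIcc_of_le (by linarith)]; exact Ioo_subset_Icc_self hξ, ?_⟩
    rw [he, add_sub_cancel_left]
    field_simp

lemma velocity_le (h : IntegralCurve T v w) {M : ℝ} (hM : ∀ t, |w t| ≤ M) (t s : ℝ) :
    v (t + s) ≤ Real.exp (M * |s|) * v t := by
  obtain ⟨ξ, -, he⟩ := h.velocity_add t s
  rw [he]
  refine mul_le_mul_of_nonneg_right (Real.exp_le_exp.2 ?_) (h.pos t).le
  calc s * w ξ ≤ |s * w ξ| := le_abs_self _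
    _ = |w ξ| * |s| := by rw [abs_mul, mul_comm]
    _ ≤ M * |s| := mul_le_mul_of_nonneg_right (hM ξ) (abs_nonneg _)

lemma continuous_T (h : IntegralCurve T v w) : Continuous T :=
  continuous_iff_continuousAt.2 fun t => (h.deriv_T t).continuousAt

lemma continuous_v (h : IntegralCurve T v w) : Continuous v :=
  continuous_iff_continuousAt.2 fun t => (h.deriv_v t).continuousAt

lemma strictMono (h : IntegralCurve T v w) : StrictMono T :=
  strictMono_of_hasDerivAt_pos h.deriv_T h.pos

lemma velocity_le_sub (h : IntegralCurve T v w) {M : ℝ} (hM : ∀ t, |w t| ≤ M) (t : ℝ) :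
    v t ≤ Real.exp M * (T (t + 1) - T t) := by
  have hM0 : 0 ≤ M := (abs_nonneg _).trans (hM 0)
  obtain ⟨ξ, hξ, he⟩ := exists_hasDerivAt_eq_slope T v (show t < t + 1 by linarith)
    h.continuous_T.continuousOn fun x _ => h.deriv_T x
  rw [add_sub_cancel_left, div_one] at he
  have := h.velocity_le hM ξ (t - ξ)
  rw [add_sub_cancel] at this
  refine this.trans ?_
  rw [← he]
  refine mul_le_mul_of_nonneg_right (Real.exp_le_exp.2 ?_) (h.pos _).le
  refine mul_le_of_le_one_right hM0 ?_
  rw [abs_le]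
  constructor <;> linarith [hξ.1, hξ.2]

lemma sum_velocity_le (h : IntegralCurve T v w) {M : ℝ} (hM : ∀ t, |w t| ≤ M) (t : ℝ) (N : ℕ) :
    ∑ n ∈ Finset.range N, v (t + n) ≤ Real.exp M := by
  calc ∑ n ∈ Finset.range N, v (t + n)
      ≤ ∑ n ∈ Finset.range N, Real.exp M * (T (t + (n + 1 : ℕ)) - T (t + n)) := by
        refine Finset.sum_le_sum fun n _ => ?_
        have := h.velocity_le_sub hM (t + n)
        rwa [add_assoc, ← Nat.cast_succ] at this
    _ = Real.exp M * (T (t + N) - T (t + (0 : ℕ))) := by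
        rw [← Finset.mul_sum, Finset.sum_range_sub fun n : ℕ => T (t + n)]
    _ ≤ Real.exp M * 1 := by
        refine mul_le_mul_of_nonneg_left ?_ (Real.exp_pos _).le
        linarith [(h.mem (t + N)).2, (h.mem (t + (0 : ℕ))).1]
    _ = Real.exp M := mul_one _

lemma summable_velocity (h : IntegralCurve T v w) (t : ℝ) : Summable fun n : ℕ => v (t + n) := by
  obtain ⟨M, hM⟩ := h.bdd_w
  exact summable_of_sum_range_le (fun _ => (h.pos _).le) (h.sum_velocity_le hM t)

lemma tsum_velocity_le (h : IntegralCurve T v w) {M : ℝ} (hM : ∀ t, |w t| ≤ M) (t : ℝ) :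
    ∑' n : ℕ, v (t + n) ≤ Real.exp M :=
  Real.tsum_le_of_sum_range_le (fun _ => (h.pos _).le) (h.sum_velocity_le hM t)

lemma hasDerivAt_comp (h : IntegralCurve T v w) {q : ℝ → ℝ}
    (hq : DifferentiableOn ℝ q (Icc 0 1)) (t : ℝ) :
    HasDerivAt (fun t => q (T t)) (derivWithin q (Icc 0 1) (T t) * v t) t := by
  have hn : Icc (0 : ℝ) 1 ∈ 𝓝 (T t) := Icc_mem_nhds (h.mem t).1 (h.mem t).2
  have := (hq (T t)
    (Ioo_subset_Icc_self (h.mem t))).hasDerivWithinAt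
  exact (this.hasDerivAt hn).comp t (h.deriv_T t)

lemma bddDeriv_velocity (h : IntegralCurve T v w) {k : ℕ} (hw : BddDeriv k w) :
    BddDeriv (k + 1) v := by
  have hb : ∃ C, ∀ t, |v t| ≤ C := by
    obtain ⟨M, hM⟩ := h.bdd_w
    refine ⟨Real.exp M, fun t => ?_⟩
    rw [abs_of_pos (h.pos t)]
    simpa using h.sum_velocity_le hM t 1
  induction k with
  | zero =>
    exact ⟨hb, _, h.deriv_v, BddDeriv.mul hw ⟨h.continuous_v, hb⟩⟩
  | succ k ih => exact ⟨hb, _, h.deriv_v, hw.mul (ih hw.of_succ)⟩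

lemma bddDeriv_comp (h : IntegralCurve T v w) {k : ℕ} (hw : BddDeriv k w) {p : ℝ → ℝ}
    (hp : ContDiffOn ℝ ∞ p (Icc 0 1)) : BddDeriv (k + 1) fun t => p (T t) := by
  have hb : ∀ q : ℝ → ℝ, ContDiffOn ℝ ∞ q (Icc 0 1) →
      Continuous (fun t => q (T t)) ∧ ∃ C, ∀ t, |q (T t)| ≤ C := by
    intro q hq
    refine ⟨hq.continuousOn.comp_continuous h.continuous_T
      fun t => Ioo_subset_Icc_self (h.mem t), ?_⟩
    obtain ⟨C, hC⟩ := isCompact_Icc.exists_bound_of_continuousOn hq.continuousOn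
    exact ⟨C, fun t => hC _ (Ioo_subset_Icc_self (h.mem t))⟩
  have hu : UniqueDiffOn ℝ (Icc (0 : ℝ) 1) := uniqueDiffOn_Icc zero_lt_one
  have hv := h.bddDeriv_velocity hw
  suffices H : ∀ j ≤ k + 1, ∀ q : ℝ → ℝ, ContDiffOn ℝ ∞ q (Icc 0 1) →
      BddDeriv j fun t => q (T t) from H _ le_rfl p hp
  intro j
  induction j with
  | zero => exact fun _ q hq => hb q hq
  | succ j ih =>
    intro hj q hq
    refine ⟨(hb q hq).2, _, h.hasDerivAt_comp (hq.differentiableOn (by simp)), 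
      (ih (by omega) _ (hq.derivWithin hu (by simp))).mul (hv.of_le (by omega))⟩

lemma summable_shift (h : IntegralCurve T v w) {p : ℝ → ℝ} {C : ℝ} (hC : ∀ t, |p t| ≤ C) (t : ℝ) :
    Summable fun n : ℕ => p (t + n) * v (t + n) := by
  refine Summable.of_norm_bounded ((h.summable_velocity t).mul_left C) fun n => ?_
  rw [norm_mul, Real.norm_of_nonneg (h.pos _).le]
  exact mul_le_mul_of_nonneg_right (hC _) (h.pos _).le

lemma shift_le (h : IntegralCurve T v w) {M : ℝ} (hM : ∀ t, |w t| ≤ M) {p : ℝ → ℝ} {C : ℝ}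
    (hC : ∀ t, |p t| ≤ C) {R t : ℝ} (ht : |t| ≤ R) (n : ℕ) :
    ‖p (t + n) * v (t + n)‖ ≤ C * Real.exp (M * R) * v n := by
  have hM0 : 0 ≤ M := (abs_nonneg _).trans (hM 0)
  rw [norm_mul, Real.norm_of_nonneg (h.pos _).le, mul_assoc]
  refine mul_le_mul (hC _) ?_ (h.pos _).le ((abs_nonneg _).trans (hC 0))
  rw [add_comm]
  refine (h.velocity_le hM n t).trans (mul_le_mul_of_nonneg_right (Real.exp_le_exp.2 ?_)
    (h.pos _).le)
  exact mul_le_mul_of_nonneg_left ht hM0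

lemma bddDeriv_tsum (h : IntegralCurve T v w) {k : ℕ} (hw : BddDeriv k w) {p : ℝ → ℝ}
    (hp : BddDeriv (k + 1) p) : BddDeriv (k + 1) fun t => ∑' n : ℕ, p (t + n) * v (t + n) := by
  obtain ⟨M, hM⟩ := h.bdd_w
  have hs0 : Summable fun n : ℕ => v n := by simpa using h.summable_velocity 0
  have hb : ∀ q : ℝ → ℝ, (∃ C, ∀ t, |q t| ≤ C) →
      ∃ C, ∀ t, |∑' n : ℕ, q (t + n) * v (t + n)| ≤ C := by
    rintro q ⟨C, hC⟩
    have hC0 : 0 ≤ C := (abs_nonneg _).trans (hC 0)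
    refine ⟨C * Real.exp M, fun t => ?_⟩
    calc |∑' n : ℕ, q (t + n) * v (t + n)| ≤ ∑' n : ℕ, C * v (t + n) := by
          refine tsum_of_norm_bounded (E := ℝ) ((h.summable_velocity t).mul_left C).hasSum fun n => ?_
          rw [norm_mul, Real.norm_of_nonneg (h.pos _).le]
          exact mul_le_mul_of_nonneg_right (hC _) (h.pos _).le
      _ ≤ C * Real.exp M := by
          rw [tsum_mul_left]
          exact mul_le_mul_of_nonneg_left (h.tsum_velocity_le hM t) hC0
  suffices H : ∀ j ≤ k + 1, ∀ q, BddDeriv j q →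
      BddDeriv j fun t => ∑' n : ℕ, q (t + n) * v (t + n) from H _ le_rfl p hp
  intro j
  induction j with
  | zero =>
    rintro - q hq
    refine ⟨?_, hb q hq.2⟩
    obtain ⟨C, hC⟩ := hq.2
    refine continuous_iff_continuousAt.2 fun t => ?_
    have hcont : ContinuousOn (fun t => ∑' n : ℕ, q (t + n) * v (t + n))
        (Metric.ball 0 (|t| + 1)) := by
      refine continuousOn_tsum (fun n => ?_)
        (hs0.mul_left (C * Real.exp (M * (|t| + 1)))) fun n s hs => ?_
      · have h1 := hq.1
        have h2 := h.continuous_v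
        fun_prop
      · exact h.shift_le hM hC (by simpa using (Metric.mem_ball.1 hs).le) n
    exact hcont.continuousAt (Metric.isOpen_ball.mem_nhds (by simp))
  | succ j ih =>
    intro hj q hq
    obtain ⟨hqb, q', hq', hk'⟩ := id hq
    have hr : BddDeriv j fun t => q' t + q t * w t :=
      hk'.add (hq.of_succ.mul (hw.of_le (by omega)))
    refine ⟨hb q hqb, _, fun t => ?_, ih (by omega) _ hr⟩
    obtain ⟨C, hC⟩ := hr.bounded
    obtain ⟨C', hC'⟩ := hqb
    refine hasDerivAt_tsum_of_isPreconnected (t := Metric.ball 0 (|t| + 1)) (y₀ := t)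
      (g := fun (n : ℕ) t => q (t + n) * v (t + n))
      (g' := fun (n : ℕ) t => (q' (t + n) + q (t + n) * w (t + n)) * v (t + n))
      (hs0.mul_left (C * Real.exp (M * (|t| + 1)))) Metric.isOpen_ball
      (convex_ball _ _).isPreconnected (fun n y _ => ?_) (fun n y hy => ?_) (by simp)
      (h.summable_shift hC' t) (by simp)
    · have h1 := (hq' (y + n)).comp_add_const y n
      have h2 := (h.deriv_v (y + n)).comp_add_const y n
      exact (h1.mul h2).congr_deriv (by ring)
    · exact h.shift_le hM hC (by simpa using (Metric.mem_ball.1 hy).le) n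

/-- An integral curve of a `C¹` vector field is smooth when the translation of time by `1` acts
on it as a smooth map and its logarithmic acceleration converges at infinity. -/
theorem contDiff_of_shift (h : IntegralCurve T v w) {l : ℝ} (hl : Tendsto w atTop (𝓝 l))
    {F : ℝ → ℝ} (hF : ContDiffOn ℝ ∞ F (Icc 0 1))
    (hF' : ∀ x ∈ Icc (0 : ℝ) 1, derivWithin F (Icc 0 1) x ≠ 0) (hFT : ∀ t, F (T t) = T (t + 1)) :
    ContDiff ℝ ∞ T := by
  have hu : UniqueDiffOn ℝ (Icc (0 : ℝ) 1) := uniqueDiffOn_Icc zero_lt_one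
  set F' := derivWithin F (Icc 0 1) with hF'def
  have hFs : ContDiffOn ℝ ∞ F' (Icc 0 1) := hF.derivWithin hu (by simp)
  set F'' := derivWithin F' (Icc 0 1) with hF''def
  have hFs' : ContDiffOn ℝ ∞ F'' (Icc 0 1) := hFs.derivWithin hu (by simp)
  have hv1 : ∀ t, v (t + 1) = F' (T t) * v t := fun t => by
    have h1 := h.hasDerivAt_comp (hF.differentiableOn (by simp)) t
    simp only [hFT] at h1
    exact ((h.deriv_T (t + 1)).comp_add_const t 1).unique h1
  have hF'T : ∀ t, F' (T t) ≠ 0 := fun t => hF' _ (Ioo_subset_Icc_self (h.mem t))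
  have hw1 : ∀ t, w (t + 1) = w t + F'' (T t) / F' (T t) * v t := fun t => by
    have h1 := (h.hasDerivAt_comp (hFs.differentiableOn (by simp)) t).mul (h.deriv_v t)
    have h2 : (fun t => v (t + 1)) = (fun t => F' (T t)) * v := funext hv1
    rw [← h2] at h1
    have h3 := ((h.deriv_v (t + 1)).comp_add_const t 1).unique h1
    rw [hv1] at h3
    have h4 := hF'T t
    have h5 := (h.pos t).ne'
    field_simp
    have h6 : (w (t + 1) * F' (T t)) * v t = (F'' (T t) * v t + F' (T t) * w t) * v t := by
      linarith
    linarith [mul_right_cancel₀ h5 h6]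
  set p : ℝ → ℝ := fun x => F'' x / F' x with hpdef
  have hp : ContDiffOn ℝ ∞ p (Icc 0 1) := hFs'.div hFs hF'
  have hpb : ∃ C, ∀ t, |p (T t)| ≤ C := by
    obtain ⟨C, hC⟩ := isCompact_Icc.exists_bound_of_continuousOn hp.continuousOn
    exact ⟨C, fun t => hC _ (Ioo_subset_Icc_self (h.mem t))⟩
  obtain ⟨C, hC⟩ := hpb
  have hw : w = fun t => l + (-1) * ∑' n : ℕ, p (T (t + n)) * v (t + n) := by
    funext t
    have hsum := (h.summable_shift (p := fun t => p (T t)) hC t).hasSum.tendsto_sum_nat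
    have hpart : ∀ N : ℕ, ∑ n ∈ Finset.range N, p (T (t + n)) * v (t + n) = w (t + N) - w t := by
      intro N
      induction N with
      | zero => simp
      | succ N ih =>
        rw [Finset.sum_range_succ, ih, Nat.cast_succ, ← add_assoc, hw1 (t + N)]
        ring
    simp only [hpart] at hsum
    have hlim : Tendsto (fun N : ℕ => w (t + N) - w t) atTop (𝓝 (l - w t)) :=
      (hl.comp (tendsto_atTop_add_const_left _ t tendsto_natCast_atTop_atTop)).sub_const _
    have := tendsto_nhds_unique hsum hlim
    linarith
  have hwk : ∀ k, BddDeriv k w := by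
    intro k
    induction k with
    | zero => exact ⟨h.cont_w, h.bdd_w⟩
    | succ k ih =>
      rw [hw]
      exact (BddDeriv.const l).add
        ((BddDeriv.const (-1)).mul (h.bddDeriv_tsum ih (h.bddDeriv_comp ih hp)))
  have hid : ContDiffOn ℝ ∞ (fun x : ℝ => x) (Icc 0 1) := contDiffOn_id
  rw [contDiff_infty]
  intro n
  exact (h.bddDeriv_comp (hwk n) hid).of_succ.contDiff

end IntegralCurve

namespace IntegralCurve

variable {T v w : ℝ → ℝ}

lemma reflect (h : IntegralCurve T v w) :
    IntegralCurve (fun t => 1 - T (-t)) (fun t => v (-t)) (fun t => -w (-t)) where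
  mem t := ⟨by linarith [(h.mem (-t)).2], by linarith [(h.mem (-t)).1]⟩
  deriv_T t := by
    have := ((h.deriv_T (-t)).comp t (hasDerivAt_neg t)).const_sub 1
    exact this.congr_deriv (by ring)
  pos t := h.pos _
  deriv_v t := ((h.deriv_v (-t)).comp t (hasDerivAt_neg t)).congr_deriv (by ring)
  cont_w := (h.cont_w.comp continuous_neg).neg
  bdd_w := by
    obtain ⟨M, hM⟩ := h.bdd_w
    exact ⟨M, fun t => by simpa using hM (-t)⟩

lemma tendsto_top (h : IntegralCurve T v w) {Y : ℝ → ℝ} (hY : ContinuousOn Y (Icc 0 1))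
    (hY0 : ∀ x ∈ Ioo (0 : ℝ) 1, Y x ≠ 0) (hv : ∀ t, v t = Y (T t)) :
    Tendsto T atTop (𝓝 1) := by
  have hbdd : BddAbove (range T) := ⟨1, by rintro _ ⟨t, rfl⟩; exact (h.mem t).2.le⟩
  have hlim := tendsto_atTop_ciSup h.strictMono.monotone hbdd
  set L := ⨆ t, T t
  have hL0 : 0 < L := (h.mem 0).1.trans_le (le_ciSup hbdd 0)
  have hL1 : L ≤ 1 := ciSup_le fun t => (h.mem t).2.le
  have hv0 : Tendsto (fun n : ℕ => v n) atTop (𝓝 0) := by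
    simpa using (h.summable_velocity 0).tendsto_atTop_zero
  have hvL : Tendsto (fun n : ℕ => v n) atTop (𝓝 (Y L)) := by
    simp only [hv]
    refine (hY L ⟨hL0.le, hL1⟩).tendsto.comp (tendsto_nhdsWithin_iff.2
      ⟨hlim.comp tendsto_natCast_atTop_atTop, Eventually.of_forall fun n => ?_⟩)
    exact Ioo_subset_Icc_self (h.mem _)
  have hYL := tendsto_nhds_unique hvL hv0
  have : L = 1 := by
    by_contra hne
    exact hY0 L ⟨hL0, lt_of_le_of_ne hL1 hne⟩ hYL
  rwa [this] at hlim

lemma tendsto_bot (h : IntegralCurve T v w) {Y : ℝ → ℝ} (hY : ContinuousOn Y (Icc 0 1))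
    (hY0 : ∀ x ∈ Ioo (0 : ℝ) 1, Y x ≠ 0) (hv : ∀ t, v t = Y (T t)) :
    Tendsto T atBot (𝓝 0) := by
  have h1 : Tendsto (fun t => 1 - T (-t)) atTop (𝓝 1) := by
    refine h.reflect.tendsto_top (Y := fun x => Y (1 - x)) ?_ ?_ fun t => by simp [hv]
    · exact hY.comp (by fun_prop) fun x hx => ⟨by linarith [hx.2], by linarith [hx.1]⟩
    · exact fun x hx => hY0 _ ⟨by linarith [hx.2], by linarith [hx.1]⟩
  have h2 := (h1.comp tendsto_neg_atBot_atTop).const_sub 1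
  simpa [Function.comp_def] using h2

lemma tendsto_velocity_ratio (h : IntegralCurve T v w) {F : Filter ℝ} (hF : F = atTop ∨ F = atBot)
    {l : ℝ} (hl : Tendsto w F (𝓝 l)) (s : ℝ) :
    Tendsto (fun t => v (t + s) / v t) F (𝓝 (Real.exp (s * l))) := by
  choose ξ hξ he using fun t => h.velocity_add t s
  have hξF : Tendsto ξ F F := by
    rcases hF with rfl | rfl
    · refine tendsto_atTop_mono (fun t => ?_) (tendsto_atTop_add_const_right _ (-|s|) tendsto_id)
      have := (hξ t).1
      refine le_trans (le_min ?_ ?_) this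
      · simp
      · simp only [id]; linarith [neg_abs_le s]
    · refine tendsto_atBot_mono (fun t => ?_) (tendsto_atBot_add_const_right _ (|s|) tendsto_id)
      have := (hξ t).2
      refine this.trans (max_le ?_ ?_)
      · simp
      · simp only [id]; linarith [le_abs_self s]
  have heq : (fun t => v (t + s) / v t) = fun t => Real.exp (s * w (ξ t)) := by
    funext t
    rw [he, mul_div_cancel_right₀ _ (h.pos t).ne']
  rw [heq]
  exact (Real.continuous_exp.tendsto _).comp ((hl.comp hξF).const_mul s)

lemma exists_tendsto_sub_div (h : IntegralCurve T v w) {l : ℝ} (hl : Tendsto w atBot (𝓝 l)) :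
    ∃ K > 0, Tendsto (fun t => (T t - T (t - 1)) / v t) atBot (𝓝 K) := by
  obtain ⟨M, hM⟩ := h.bdd_w
  refine ⟨∫ s in (-1 : ℝ)..0, Real.exp (s * l), ?_, ?_⟩
  · refine intervalIntegral.intervalIntegral_pos_of_pos ?_ (fun x => Real.exp_pos _) (by norm_num)
    exact Continuous.intervalIntegrable (by fun_prop) _ _
  · have heq : (fun t => (T t - T (t - 1)) / v t) =
        fun t => ∫ s in (-1 : ℝ)..0, v (t + s) / v t := by
      funext t
      rw [intervalIntegral.integral_div]
      congr 1
      have hc := h.continuous_v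
      rw [intervalIntegral.integral_eq_sub_of_hasDerivAt (f := fun s => T (t + s))
        (fun s _ => (h.deriv_T (t + s)).comp_const_add t s)
        (Continuous.intervalIntegrable (by fun_prop) _ _)]
      simp [sub_eq_add_neg]
    rw [heq]
    refine intervalIntegral.tendsto_integral_filter_of_dominated_convergence
      (fun _ => Real.exp M) (Eventually.of_forall fun t => ?_)
      (Eventually.of_forall fun t => Eventually.of_forall fun s hs => ?_)
      (by simp) (Eventually.of_forall fun s _ => h.tendsto_velocity_ratio (Or.inr rfl) hl s)
    · have hc := h.continuous_v
      exact Continuous.aestronglyMeasurable (by fun_prop)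
    · rw [Real.norm_of_nonneg (div_nonneg (h.pos _).le (h.pos _).le), div_le_iff₀ (h.pos t)]
      refine (h.velocity_le hM t s).trans (mul_le_mul_of_nonneg_right (Real.exp_le_exp.2 ?_)
        (h.pos _).le)
      refine mul_le_of_le_one_right ((abs_nonneg _).trans (hM 0)) ?_
      rw [uIoc_of_le (by norm_num)] at hs
      exact abs_le.2 ⟨hs.1.le, hs.2.trans zero_le_one⟩

end IntegralCurve

/-- An integral curve `T` filling `(0,1)`, with inverse `S`, whose logarithmic acceleration
converges at both ends. -/
structure FlowLine (T v w S : ℝ → ℝ) : Prop extends IntegralCurve T v w where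
  w_bot : ∃ l, Tendsto w atBot (𝓝 l)
  w_top : ∃ l, Tendsto w atTop (𝓝 l)
  T_bot : Tendsto T atBot (𝓝 0)
  T_top : Tendsto T atTop (𝓝 1)
  S_T : ∀ t, S (T t) = t
  T_S : ∀ x ∈ Ioo (0 : ℝ) 1, T (S x) = x

namespace FlowLine

variable {T v w S : ℝ → ℝ}

lemma reflect (h : FlowLine T v w S) :
    FlowLine (fun t => 1 - T (-t)) (fun t => v (-t)) (fun t => -w (-t))
      (fun x => -S (1 - x)) where
  toIntegralCurve := h.toIntegralCurve.reflect
  w_bot := by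
    obtain ⟨l, hl⟩ := h.w_top
    exact ⟨-l, (hl.comp tendsto_neg_atBot_atTop).neg⟩
  w_top := by
    obtain ⟨l, hl⟩ := h.w_bot
    exact ⟨-l, (hl.comp tendsto_neg_atTop_atBot).neg⟩
  T_bot := by simpa using (h.T_top.comp tendsto_neg_atBot_atTop).const_sub 1
  T_top := by simpa using (h.T_bot.comp tendsto_neg_atTop_atBot).const_sub 1
  S_T t := by simp [h.S_T]
  T_S x hx := by
    have := h.T_S (1 - x) ⟨by linarith [hx.2], by linarith [hx.1]⟩
    simp [this]

lemma exists_openPartialHomeomorph (h : FlowLine T v w S) :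
    ∃ e : OpenPartialHomeomorph ℝ ℝ, e.target = Ioo 0 1 ∧ (∀ t, e t = T t) ∧
      ∀ x ∈ Ioo (0 : ℝ) 1, e.symm x = S x := by
  have hr : range T = Ioo 0 1 := by
    ext x
    refine ⟨?_, fun hx => ⟨S x, h.T_S x hx⟩⟩
    rintro ⟨t, rfl⟩
    exact h.mem t
  have ho : IsOpenEmbedding T :=
    ⟨h.strictMono.isEmbedding_of_ordConnected (hr ▸ ordConnected_Ioo), hr ▸ isOpen_Ioo⟩
  refine ⟨ho.toOpenPartialHomeomorph T, by simpa using hr, fun t => rfl, fun x hx => ?_⟩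
  have := (ho.toOpenPartialHomeomorph T).right_inv (x := x) (by simpa [hr] using hx)
  exact h.strictMono.injective (this.trans (h.T_S x hx).symm)

lemma hasDerivAt_S (h : FlowLine T v w S) (t : ℝ) : HasDerivAt S (v t)⁻¹ (T t) := by
  obtain ⟨e, ht, he, hs⟩ := h.exists_openPartialHomeomorph
  have hee : (e : ℝ → ℝ) = T := funext he
  have h1 := e.hasDerivAt_symm (ht ▸ h.mem t) (h.pos t).ne'
    (by rw [hs _ (h.mem t), h.S_T, hee]; exact h.deriv_T t)
  refine h1.congr_of_eventuallyEq ?_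
  filter_upwards [isOpen_Ioo.mem_nhds (h.mem t)] with x hx using (hs x hx).symm

lemma contDiffOn_S (h : FlowLine T v w S) (hT : ContDiff ℝ ∞ T) : ContDiffOn ℝ ∞ S (Ioo 0 1) := by
  obtain ⟨e, ht, he, hs⟩ := h.exists_openPartialHomeomorph
  have hee : (e : ℝ → ℝ) = T := funext he
  intro x hx
  have h1 := e.contDiffAt_symm_deriv (n := ∞) (h.pos (S x)).ne' (ht ▸ hx)
    (by rw [hs x hx, hee]; exact h.deriv_T _) (by rw [hee]; exact hT.contDiffAt)
  refine (h1.congr_of_eventuallyEq ?_).contDiffWithinAt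
  filter_upwards [isOpen_Ioo.mem_nhds hx] with y hy using (hs y hy).symm

lemma tendsto_S_bot (h : FlowLine T v w S) : Tendsto S (𝓝[>] 0) atBot := by
  refine tendsto_atBot.2 fun b => ?_
  filter_upwards [Ioo_mem_nhdsGT (h.mem b).1] with x hx
  have hx' : x ∈ Ioo (0 : ℝ) 1 := ⟨hx.1, hx.2.trans (h.mem b).2⟩
  rw [← h.strictMono.le_iff_le, h.T_S x hx']
  exact hx.2.le

lemma tendsto_S_top (h : FlowLine T v w S) : Tendsto S (𝓝[<] 1) atTop := by
  refine tendsto_atTop.2 fun b => ?_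
  filter_upwards [Ioo_mem_nhdsLT (h.mem b).2] with x hx
  have hx' : x ∈ Ioo (0 : ℝ) 1 := ⟨(h.mem b).1.trans hx.1, hx.2⟩
  rw [← h.strictMono.le_iff_le, h.T_S x hx']
  exact hx.1.le

end FlowLine

lemma DiffIcc.derivWithin_invFun_ne_zero (f : DiffIcc ⊤) {x : ℝ} (hx : x ∈ Icc (0 : ℝ) 1) :
    derivWithin f.invFun (Icc 0 1) x ≠ 0 := by
  have hu : UniqueDiffWithinAt ℝ (Icc (0 : ℝ) 1) x := uniqueDiffOn_Icc zero_lt_one x hx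
  have h1 := (f.smooth_inv.differentiableOn (by simp) x hx).hasDerivWithinAt
  have h2 := (f.smooth.differentiableOn (by simp) _ (f.maps_inv hx)).hasDerivWithinAt
  have h3 := (h2.comp x h1 f.maps_inv).congr (f₁ := id)
    (fun y hy => (f.right_inv y hy).symm) (f.right_inv x hx).symm
  have h4 := hu.eq_deriv _ h3 (hasDerivWithinAt_id x _)
  intro h0
  simp [h0] at h4

theorem exists_flowLine {X : ℝ → ℝ} (hX1 : ContDiffOn ℝ 1 X (Icc 0 1))
    (hXzero : ∀ x ∈ Icc (0 : ℝ) 1, (X x = 0 ↔ x = 0 ∨ x = 1)) {Φ : ℝ → ℝ → ℝ}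
    (hΦ0 : ∀ x ∈ Icc (0 : ℝ) 1, Φ 0 x = x)
    (hΦ : ∀ x ∈ Icc (0 : ℝ) 1, ∀ t : ℝ,
      Φ t x ∈ Icc (0 : ℝ) 1 ∧ HasDerivAt (fun s => Φ s x) (X (Φ t x)) t)
    {f : DiffIcc ⊤} (hfX : ∀ x ∈ Icc (0 : ℝ) 1, f.toFun x = Φ 1 x) :
    ∃ (T v w S : ℝ → ℝ) (ε : ℝ), FlowLine T v w S ∧ ContDiff ℝ ∞ T ∧ (ε = 1 ∨ ε = -1) ∧
      (∀ t, X (T t) = ε * v t) ∧ (∀ s t, Φ s (T t) = T (t + ε * s)) ∧ ∀ s, Φ s 1 = 1 := by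
  have hu : UniqueDiffOn ℝ (Icc (0 : ℝ) 1) := uniqueDiffOn_Icc zero_lt_one
  have hXd : DifferentiableOn ℝ X (Icc 0 1) := hX1.differentiableOn (by simp)
  have hXc : ContinuousOn X (Icc 0 1) := hX1.continuousOn
  have hX'c : ContinuousOn (derivWithin X (Icc 0 1)) (Icc 0 1) :=
    ((contDiffOn_one_iff_derivWithin hu).1 hX1).2
  obtain ⟨C, hC⟩ := isCompact_Icc.exists_bound_of_continuousOn hX'c
  have hC0 : 0 ≤ C := (norm_nonneg _).trans (hC 0 (by simp))
  have hLip : LipschitzOnWith ⟨C, hC0⟩ X (Icc 0 1) :=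
    (convex_Icc 0 1).lipschitzOnWith_of_nnnorm_derivWithin_le hXd fun x hx => hC x hx
  have huniq : ∀ γ₁ γ₂ : ℝ → ℝ, (∀ t, HasDerivAt γ₁ (X (γ₁ t)) t ∧ γ₁ t ∈ Icc (0 : ℝ) 1) →
      (∀ t, HasDerivAt γ₂ (X (γ₂ t)) t ∧ γ₂ t ∈ Icc (0 : ℝ) 1) →
      ∀ t₀, γ₁ t₀ = γ₂ t₀ → γ₁ = γ₂ := fun γ₁ γ₂ h₁ h₂ t₀ h =>
    ODE_solution_unique_univ (v := fun _ => X) (s := fun _ => Icc 0 1) (fun _ => hLip) h₁ h₂ h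
  have hsol : ∀ x ∈ Icc (0 : ℝ) 1,
      ∀ t, HasDerivAt (fun s => Φ s x) (X (Φ t x)) t ∧ Φ t x ∈ Icc (0 : ℝ) 1 :=
    fun x hx t => (hΦ x hx t).symm
  have hfix : ∀ c ∈ Icc (0 : ℝ) 1, X c = 0 →
      ∀ t, HasDerivAt (fun _ : ℝ => c) (X c) t ∧ c ∈ Icc (0 : ℝ) 1 :=
    fun c hc h t => ⟨h ▸ hasDerivAt_const t c, hc⟩
  have hX0 : X 0 = 0 := (hXzero 0 (by simp)).2 (Or.inl rfl)
  have hX1' : X 1 = 0 := (hXzero 1 (by simp)).2 (Or.inr rfl)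
  have hXne : ∀ x ∈ Ioo (0 : ℝ) 1, X x ≠ 0 := fun x hx h => by
    rcases (hXzero x (Ioo_subset_Icc_self hx)).1 h with h | h
    · exact hx.1.ne' h
    · exact hx.2.ne h
  have hhalf : (1 / 2 : ℝ) ∈ Icc (0 : ℝ) 1 := by norm_num
  have hmem : ∀ t, Φ t (1 / 2) ∈ Ioo (0 : ℝ) 1 := by
    have hne : ∀ c ∈ Icc (0 : ℝ) 1, X c = 0 → c ≠ 1 / 2 → ∀ t, c ≠ Φ t (1 / 2) := by
      intro c hc hXc hc2 t ht
      have := congrFun (huniq _ _ (hfix c hc hXc) (hsol _ hhalf) t ht) 0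
      rw [hΦ0 _ hhalf] at this
      exact hc2 this
    intro t
    have := (hΦ _ hhalf t).1
    exact ⟨lt_of_le_of_ne this.1 (hne 0 (by simp) hX0 (by norm_num) t),
      lt_of_le_of_ne this.2 (hne 1 (by simp) hX1' (by norm_num) t).symm⟩
  obtain ⟨ε, hε, hpos⟩ : ∃ ε : ℝ, (ε = 1 ∨ ε = -1) ∧ ∀ x ∈ Ioo (0 : ℝ) 1, 0 < ε * X x := by
    have hsign : (∀ x ∈ Ioo (0 : ℝ) 1, 0 < X x) ∨ ∀ x ∈ Ioo (0 : ℝ) 1, X x < 0 := by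
      by_contra! hcon
      obtain ⟨⟨x, hx, hx0⟩, y, hy, hy0⟩ := hcon
      obtain ⟨z, hz, hz0⟩ := isPreconnected_Ioo.intermediate_value hx hy
        (hXc.mono Ioo_subset_Icc_self) ⟨hx0, hy0⟩
      exact hXne z hz hz0
    rcases hsign with h | h
    · exact ⟨1, Or.inl rfl, fun x hx => by simpa using h x hx⟩
    · exact ⟨-1, Or.inr rfl, fun x hx => by simpa using h x hx⟩
  have hεε : ε * ε = 1 := by rcases hε with rfl | rfl <;> norm_num
  set T : ℝ → ℝ := fun t => Φ (ε * t) (1 / 2) with hT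
  set v : ℝ → ℝ := fun t => ε * X (T t) with hv
  set w : ℝ → ℝ := fun t => ε * derivWithin X (Icc 0 1) (T t) with hw
  have hTmem : ∀ t, T t ∈ Ioo (0 : ℝ) 1 := fun t => hmem _
  have hTI : ∀ t, T t ∈ Icc (0 : ℝ) 1 := fun t => Ioo_subset_Icc_self (hTmem t)
  have hTd : ∀ t, HasDerivAt T (v t) t := fun t => by
    have h1 : HasDerivAt (fun t : ℝ => ε * t) ε t := by
      simpa using (hasDerivAt_id t).const_mul ε
    exact ((hΦ _ hhalf (ε * t)).2.comp t h1).congr_deriv (mul_comm _ _)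
  have hTc : Continuous T := continuous_iff_continuousAt.2 fun t => (hTd t).continuousAt
  have hic : IntegralCurve T v w :=
    { mem := hTmem
      deriv_T := hTd
      pos := fun t => hpos _ (hTmem t)
      deriv_v := fun t => by
        have hn : Icc (0 : ℝ) 1 ∈ 𝓝 (T t) := Icc_mem_nhds (hTmem t).1 (hTmem t).2
        have := ((((hXd (T t) (hTI t)).hasDerivWithinAt).hasDerivAt hn).comp t (hTd t)).const_mul ε
        exact this.congr_deriv (by simp only [hw]; ring)
      cont_w := continuous_const.mul (hX'c.comp_continuous hTc hTI)
      bdd_w := ⟨|ε| * C, fun t => by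
        rw [abs_mul]
        exact mul_le_mul_of_nonneg_left (hC _ (hTI t)) (abs_nonneg _)⟩ }
  have hε0 : ε ≠ 0 := by rintro rfl; simp at hεε
  have hYc : ContinuousOn (fun x => ε * X x) (Icc 0 1) := continuousOn_const.mul hXc
  have hY0 : ∀ x ∈ Ioo (0 : ℝ) 1, ε * X x ≠ 0 := fun x hx => (hpos x hx).ne'
  have htop : Tendsto T atTop (𝓝 1) := hic.tendsto_top hYc hY0 fun t => rfl
  have hbot : Tendsto T atBot (𝓝 0) := hic.tendsto_bot hYc hY0 fun t => rfl
  have hwlim : ∀ (F : Filter ℝ), ∀ c ∈ Icc (0 : ℝ) 1, Tendsto T F (𝓝 c) →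
      ∃ l, Tendsto w F (𝓝 l) := fun F c hc h =>
    ⟨_, (((hX'c c hc).tendsto.comp (tendsto_nhdsWithin_iff.2
      ⟨h, Eventually.of_forall hTI⟩))).const_mul ε⟩
  have hsurj : ∀ x ∈ Ioo (0 : ℝ) 1, ∃ t, T t = x := fun x hx =>
    mem_range_of_exists_le_of_exists_ge hTc
      ((hbot.eventually (gt_mem_nhds hx.1)).exists.imp fun _ h => h.le)
      ((htop.eventually (lt_mem_nhds hx.2)).exists.imp fun _ h => h.le)
  have hflow : ∀ s t, Φ s (T t) = T (t + ε * s) := by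
    intro s t
    have h2 : ∀ s, HasDerivAt (fun s => T (t + ε * s)) (X (T (t + ε * s))) s ∧
        T (t + ε * s) ∈ Icc (0 : ℝ) 1 := by
      intro s
      refine ⟨?_, hTI _⟩
      have h1 : HasDerivAt (fun s : ℝ => t + ε * s) ε s := by
        simpa using ((hasDerivAt_id s).const_mul ε).const_add t
      refine ((hTd (t + ε * s)).comp s h1).congr_deriv ?_
      simp only [hv]
      linear_combination X (T (t + ε * s)) * hεε
    exact congrFun (huniq _ _ (hsol _ (hTI t)) h2 0 (by simp [hΦ0 _ (hTI t)])) s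
  refine ⟨T, v, w, Function.invFun T, ε, ⟨hic, hwlim _ 0 (by simp) hbot, hwlim _ 1 (by simp) htop,
    hbot, htop, Function.leftInverse_invFun hic.strictMono.injective,
    fun x hx => Function.invFun_eq (hsurj x hx)⟩, ?_, hε, fun t => ?_, hflow, fun s => ?_⟩
  · obtain ⟨l, hl⟩ := hwlim _ 1 (by simp) htop
    have hfT : ∀ t, f.toFun (T t) = T (t + ε) := fun t => by
      rw [hfX _ (hTI t), hflow, mul_one]
    rcases hε with rfl | rfl
    · exact hic.contDiff_of_shift hl f.smooth (fun x hx => (f.deriv_pos x hx).ne') hfT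
    · refine hic.contDiff_of_shift hl f.smooth_inv
        (fun x hx => f.derivWithin_invFun_ne_zero hx) fun t => ?_
      have h1 := hfT (t + 1)
      rw [add_neg_cancel_right] at h1
      rw [← h1, f.left_inv _ (hTI _)]
  · simp only [hv]
    linear_combination -X (T t) * hεε
  · exact congrFun (huniq _ _ (hsol 1 (by simp)) (hfix 1 (by simp) hX1') 0
      (hΦ0 1 (by simp))) s

namespace FlowLine

variable {T₁ v₁ w₁ S₁ T₂ v₂ w₂ S₂ : ℝ → ℝ}

/-- Kopell's lemma: a local `C¹` conjugacy at `0` between the time-one maps of two flows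
conjugates the flows themselves. -/
theorem exists_shift_bot (h₁ : FlowLine T₁ v₁ w₁ S₁) (h₂ : FlowLine T₂ v₂ w₂ S₂)
    {φ : ℝ → ℝ} {a : ℝ} (ha : 0 < a) (hφ : ContDiffOn ℝ 1 φ (Icc 0 a)) (hφ0 : φ 0 = 0)
    (hmaps : MapsTo φ (Icc 0 a) (Icc 0 1)) (hmono : StrictMonoOn φ (Icc 0 a))
    (hderiv : ∀ x ∈ Icc 0 a, 0 < derivWithin φ (Icc 0 a) x)
    (hconj : ∀ t, T₁ t < a → S₂ (φ (T₁ (t - 1))) = S₂ (φ (T₁ t)) - 1) :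
    ∃ τ, (∀ᶠ t in atBot, φ (T₁ t) = T₂ (t + τ)) ∧
      ∃ d > 0, Tendsto (fun t => v₂ (t + τ) / v₁ t) atBot (𝓝 d) := by
  have hu : UniqueDiffOn ℝ (Icc 0 a) := uniqueDiffOn_Icc ha
  have h0a : (0 : ℝ) ∈ Icc 0 a := ⟨le_rfl, ha.le⟩
  set φ' := derivWithin φ (Icc 0 a) with hφ'
  have hφ'c : ContinuousOn φ' (Icc 0 a) := ((contDiffOn_one_iff_derivWithin hu).1 hφ).2
  have hφd : ∀ x ∈ Ioo 0 a, HasDerivAt φ (φ' x) x := fun x hx =>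
    ((hφ.differentiableOn (by simp) x (Ioo_subset_Icc_self hx)).hasDerivWithinAt).hasDerivAt
      (Icc_mem_nhds hx.1 hx.2)
  have hφI : ∀ x ∈ Ioo 0 a, φ x ∈ Ioo (0 : ℝ) 1 := fun x hx => by
    have hx' := Ioo_subset_Icc_self hx
    have haa : a ∈ Icc 0 a := ⟨ha.le, le_rfl⟩
    exact ⟨hφ0 ▸ hmono h0a hx' hx.1, (hmono hx' haa hx.2).trans_le (hmaps haa).2⟩
  obtain ⟨t₀, ht₀⟩ := eventually_atBot.1 (h₁.T_bot.eventually (gt_mem_nhds ha))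
  have hT₁ : ∀ t ≤ t₀, T₁ t ∈ Ioo 0 a := fun t ht => ⟨(h₁.mem t).1, ht₀ t ht⟩
  set α : ℝ → ℝ := fun t => S₂ (φ (T₁ t)) with hα
  have hT₂α : ∀ t ≤ t₀, T₂ (α t) = φ (T₁ t) := fun t ht => h₂.T_S _ (hφI _ (hT₁ t ht))
  set ρ : ℝ → ℝ := fun t => (v₂ (α t))⁻¹ * (φ' (T₁ t) * v₁ t) with hρ
  have hαd : ∀ t ≤ t₀, HasDerivAt α (ρ t) t := fun t ht => by
    have h := h₂.hasDerivAt_S (α t)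
    rw [hT₂α t ht] at h
    exact h.comp t ((hφd _ (hT₁ t ht)).comp t (h₁.deriv_T t))
  have hαp : ∀ t ≤ t₀, α (t - 1) = α t - 1 := fun t ht => hconj t (ht₀ t ht)
  have hρp : ∀ t < t₀, ρ (t - 1) = ρ t := fun t ht => by
    have h := (hαd (t - 1) (by linarith)).comp_sub_const t 1
    refine h.unique (((hαd t ht.le).sub_const 1).congr_of_eventuallyEq ?_)
    filter_upwards [Iio_mem_nhds ht] with s hs using hαp s (mem_Iio.1 hs).le
  have hαn : ∀ n : ℕ, ∀ t ≤ t₀, α (t - n) = α t - n := by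
    intro n t ht
    induction n with
    | zero => simp
    | succ n ih =>
      rw [Nat.cast_succ, ← sub_sub, hαp _ (by linarith [n.cast_nonneg (α := ℝ)]), ih, sub_sub]
  have hρn : ∀ n : ℕ, ∀ t < t₀, ρ (t - n) = ρ t := by
    intro n t ht
    induction n with
    | zero => simp
    | succ n ih =>
      rw [Nat.cast_succ, ← sub_sub, hρp _ (by linarith [n.cast_nonneg (α := ℝ)]), ih]
  have hmv : ∀ s, ∃ ξ, s ≤ t₀ → ξ ∈ Ioo (T₁ (s - 1)) (T₁ s) ∧
      φ (T₁ s) - φ (T₁ (s - 1)) = φ' ξ * (T₁ s - T₁ (s - 1)) := by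
    intro s
    by_cases hs : s ≤ t₀
    · have hlt : T₁ (s - 1) < T₁ s := h₁.strictMono (by linarith)
      have hsub : Icc (T₁ (s - 1)) (T₁ s) ⊆ Ioo 0 a := fun x hx =>
        ⟨(h₁.mem _).1.trans_le hx.1, hx.2.trans_lt (ht₀ s hs)⟩
      obtain ⟨ξ, hξ, he⟩ := exists_hasDerivAt_eq_slope φ φ' hlt
        (hφ.continuousOn.mono (hsub.trans Ioo_subset_Icc_self))
        fun x hx => hφd x (hsub (Ioo_subset_Icc_self hx))
      refine ⟨ξ, fun _ => ⟨hξ, ?_⟩⟩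
      rw [he, div_mul_cancel₀ _ (sub_pos.2 hlt).ne']
    · exact ⟨0, fun h => absurd h hs⟩
  choose ξ hξ using hmv
  obtain ⟨l₁, hl₁⟩ := h₁.w_bot
  obtain ⟨l₂, hl₂⟩ := h₂.w_bot
  obtain ⟨K₁, hK₁, hr₁⟩ := h₁.exists_tendsto_sub_div hl₁
  obtain ⟨K₂, hK₂, hr₂⟩ := h₂.exists_tendsto_sub_div hl₂
  have hφ'0 : ∀ {x : ℝ → ℝ}, (∀ t ≤ t₀, x t ∈ Icc 0 a) → Tendsto x atBot (𝓝 0) →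
      Tendsto (fun t => φ' (x t)) atBot (𝓝 (φ' 0)) := fun {x} hx hx0 =>
    (hφ'c 0 h0a).tendsto.comp (tendsto_nhdsWithin_iff.2
      ⟨hx0, (eventually_le_atBot t₀).mono fun t ht => hx t ht⟩)
  have hlim₁ : Tendsto (fun t => φ' (T₁ t)) atBot (𝓝 (φ' 0)) :=
    hφ'0 (fun t ht => Ioo_subset_Icc_self (hT₁ t ht)) h₁.T_bot
  have hlimξ : Tendsto (fun t => φ' (ξ t)) atBot (𝓝 (φ' 0)) := by
    refine hφ'0 (fun t ht => ⟨(h₁.mem _).1.le.trans (hξ t ht).1.1.le,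
      (hξ t ht).1.2.le.trans (ht₀ t ht).le⟩) ?_
    refine tendsto_of_tendsto_of_tendsto_of_le_of_le' tendsto_const_nhds h₁.T_bot ?_ ?_
    · filter_upwards [eventually_le_atBot t₀] with t ht
      exact (h₁.mem _).1.le.trans (hξ t ht).1.1.le
    · filter_upwards [eventually_le_atBot t₀] with t ht using (hξ t ht).1.2.le
  have hφ'pos : 0 < φ' 0 := hderiv 0 h0a
  have hρconst : ∀ t < t₀, ρ t = φ' 0 * K₂ / (φ' 0 * K₁) := by
    intro t ht
    have hn : Tendsto (fun n : ℕ => t - n) atTop atBot :=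
      tendsto_atBot_add_const_left _ t (tendsto_neg_atTop_atBot.comp tendsto_natCast_atTop_atTop)
    have hαlim : Tendsto (fun n : ℕ => α (t - n)) atTop atBot := by
      simp only [hαn _ t ht.le]
      exact tendsto_atBot_add_const_left _ (α t)
        (tendsto_neg_atTop_atBot.comp tendsto_natCast_atTop_atTop)
    have hform : ∀ s ≤ t₀, ρ s = φ' (T₁ s) * ((T₂ (α s) - T₂ (α s - 1)) / v₂ (α s)) /
        (φ' (ξ s) * ((T₁ s - T₁ (s - 1)) / v₁ s)) := by
      intro s hs
      have hlt : 0 < T₁ s - T₁ (s - 1) := sub_pos.2 (h₁.strictMono (by linarith))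
      have hξpos : 0 < φ' (ξ s) := hderiv _ ⟨(h₁.mem _).1.le.trans (hξ s hs).1.1.le,
        (hξ s hs).1.2.le.trans (ht₀ s hs).le⟩
      have hp₁ := h₁.pos s
      have hp₂ := h₂.pos (α s)
      rw [← hαp s hs, hT₂α s hs, hT₂α (s - 1) (by linarith), (hξ s hs).2]
      simp only [hρ]
      field_simp
    have hL := ((hlim₁.comp hn).mul (hr₂.comp hαlim)).div ((hlimξ.comp hn).mul (hr₁.comp hn))
      (mul_pos hφ'pos hK₁).ne'
    refine tendsto_nhds_unique (tendsto_const_nhds.congr fun n => ?_) hL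
    have hle : t - n ≤ t₀ := by linarith [n.cast_nonneg (α := ℝ)]
    rw [← hρn n t ht, hform _ hle]
    rfl
  have hslope : ∀ s t, s < t → t ≤ t₀ → ∃ ζ < t₀, ρ ζ = (α t - α s) / (t - s) := by
    intro s t hst ht
    obtain ⟨ζ, hζ, he⟩ := exists_hasDerivAt_eq_slope α ρ hst
      (fun x hx => (hαd x (hx.2.trans ht)).continuousAt.continuousWithinAt)
      fun x hx => hαd x (hx.2.le.trans ht)
    exact ⟨ζ, hζ.2.trans_le ht, he⟩
  have hρ1 : ∀ t < t₀, ρ t = 1 := by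
    intro t ht
    obtain ⟨ζ, hζ, he⟩ := hslope (t₀ - 1) t₀ (by linarith) le_rfl
    rw [hρconst t ht, ← hρconst ζ hζ, he, hαp t₀ le_rfl]
    simp
  have hαt : ∀ t < t₀, α t = t + (α t₀ - t₀) := by
    intro t ht
    obtain ⟨ζ, hζ, he⟩ := hslope t t₀ ht le_rfl
    rw [hρ1 ζ hζ, eq_div_iff (sub_pos.2 ht).ne'] at he
    linarith
  refine ⟨α t₀ - t₀, ?_, φ' 0, hφ'pos, ?_⟩
  · filter_upwards [eventually_lt_atBot t₀] with t ht
    rw [← hαt t ht, hT₂α t ht.le]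
  · refine hlim₁.congr' ?_
    filter_upwards [eventually_lt_atBot t₀] with t ht
    have h := hρ1 t ht
    have hp₁ := h₁.pos t
    have hp₂ := h₂.pos (α t)
    simp only [hρ] at h
    rw [← hαt t ht]
    field_simp at h ⊢
    linarith

theorem exists_shift_top (h₁ : FlowLine T₁ v₁ w₁ S₁) (h₂ : FlowLine T₂ v₂ w₂ S₂)
    {φ : ℝ → ℝ} {b : ℝ} (hb : 0 < b) (hφ : ContDiffOn ℝ 1 φ (Icc (1 - b) 1)) (hφ1 : φ 1 = 1)
    (hmaps : MapsTo φ (Icc (1 - b) 1) (Icc 0 1)) (hmono : StrictMonoOn φ (Icc (1 - b) 1))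
    (hderiv : ∀ x ∈ Icc (1 - b) 1, 0 < derivWithin φ (Icc (1 - b) 1) x)
    (hconj : ∀ t, 1 - b < T₁ t → S₂ (φ (T₁ (t + 1))) = S₂ (φ (T₁ t)) + 1) :
    ∃ τ, (∀ᶠ t in atTop, φ (T₁ t) = T₂ (t + τ)) ∧
      ∃ d > 0, Tendsto (fun t => v₂ (t + τ) / v₁ t) atTop (𝓝 d) := by
  have hr : MapsTo (fun x : ℝ => 1 - x) (Icc 0 b) (Icc (1 - b) 1) := fun x hx =>
    ⟨by linarith [hx.2], by linarith [hx.1]⟩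
  have key := h₁.reflect.exists_shift_bot h₂.reflect (φ := fun x => 1 - φ (1 - x)) hb
    ?_ (by simp [hφ1]) ?_ ?_ ?_ ?_
  · obtain ⟨τ, hτ, d, hd, hlim⟩ := key
    refine ⟨-τ, ?_, d, hd, ?_⟩
    · filter_upwards [tendsto_neg_atTop_atBot.eventually hτ] with t ht
      simp only [neg_neg, sub_sub_cancel, neg_add_rev] at ht
      rw [add_comm t]
      linarith
    · refine (hlim.comp tendsto_neg_atTop_atBot).congr fun t => ?_
      simp [add_comm]
  · exact contDiffOn_const.sub (hφ.comp (by fun_prop) hr)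
  · intro x hx
    have := hmaps (hr hx)
    exact ⟨by linarith [this.2], by linarith [this.1]⟩
  · intro x hx y hy hxy
    have := hmono (hr hy) (hr hx) (by linarith)
    simp only
    linarith
  · intro x hx
    have h := (hφ.differentiableOn (by simp) _ (hr hx)).hasDerivWithinAt
    have h' := (h.comp x (((hasDerivAt_id x).const_sub 1).hasDerivWithinAt) hr).const_sub 1
    have := h'.derivWithin (uniqueDiffOn_Icc hb x hx)
    simp only [Function.comp_def] at this
    rw [this]
    simpa using hderiv _ (hr hx)
  · intro t ht
    have := hconj (-t) (by linarith)
    rw [sub_sub_cancel, sub_sub_cancel, sub_sub_cancel, sub_sub_cancel, neg_sub,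
      sub_eq_neg_add, this]
    ring

end FlowLine

/-- The homeomorphism of `[0,1]` sending `T₁ t` to `T₂ (t + τ)`, where `S₁` is the inverse
of `T₁`. -/
def flowConj (S₁ T₂ : ℝ → ℝ) (τ x : ℝ) : ℝ :=
  if x ≤ 0 then 0 else if 1 ≤ x then 1 else T₂ (S₁ x + τ)

namespace FlowLine

variable {T₁ v₁ w₁ S₁ T₂ v₂ w₂ S₂ : ℝ → ℝ} {τ : ℝ}

lemma flowConj_zero : flowConj S₁ T₂ τ 0 = 0 := by simp [flowConj]

lemma flowConj_one : flowConj S₁ T₂ τ 1 = 1 := by simp [flowConj]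

lemma flowConj_of_mem {x : ℝ} (hx : x ∈ Ioo (0 : ℝ) 1) :
    flowConj S₁ T₂ τ x = T₂ (S₁ x + τ) := by
  simp [flowConj, not_le.2 hx.1, not_le.2 hx.2]

lemma flowConj_apply (h₁ : FlowLine T₁ v₁ w₁ S₁) (t : ℝ) :
    flowConj S₁ T₂ τ (T₁ t) = T₂ (t + τ) := by
  rw [flowConj_of_mem (h₁.mem t), h₁.S_T]

lemma exists_eq (h₁ : FlowLine T₁ v₁ w₁ S₁) {x : ℝ} (hx : x ∈ Icc (0 : ℝ) 1) :
    x = 0 ∨ x = 1 ∨ ∃ t, x = T₁ t := by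
  rcases hx.1.eq_or_lt with h | h
  · exact Or.inl h.symm
  rcases hx.2.eq_or_lt with h' | h'
  · exact Or.inr (Or.inl h')
  · exact Or.inr (Or.inr ⟨S₁ x, (h₁.T_S x ⟨h, h'⟩).symm⟩)

lemma flowConj_mapsTo (h₁ : FlowLine T₁ v₁ w₁ S₁) (h₂ : FlowLine T₂ v₂ w₂ S₂) :
    MapsTo (flowConj S₁ T₂ τ) (Icc 0 1) (Icc 0 1) := by
  intro x hx
  rcases h₁.exists_eq hx with rfl | rfl | ⟨t, rfl⟩
  · simp [flowConj_zero]
  · simp [flowConj_one]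
  · rw [h₁.flowConj_apply]
    exact Ioo_subset_Icc_self (h₂.mem _)

lemma flowConj_flowConj (h₁ : FlowLine T₁ v₁ w₁ S₁) (h₂ : FlowLine T₂ v₂ w₂ S₂) {σ : ℝ}
    (hσ : τ + σ = 0) {x : ℝ} (hx : x ∈ Icc (0 : ℝ) 1) :
    flowConj S₂ T₁ σ (flowConj S₁ T₂ τ x) = x := by
  rcases h₁.exists_eq hx with rfl | rfl | ⟨t, rfl⟩
  · simp [flowConj_zero]
  · simp [flowConj_one]
  · rw [h₁.flowConj_apply, h₂.flowConj_apply, add_assoc, hσ, add_zero]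

lemma contDiffOn_flowConj_Ioo (h₁ : FlowLine T₁ v₁ w₁ S₁)
    (hT₁ : ContDiff ℝ ∞ T₁) (hT₂ : ContDiff ℝ ∞ T₂) :
    ContDiffOn ℝ ∞ (flowConj S₁ T₂ τ) (Ioo 0 1) :=
  (hT₂.comp_contDiffOn ((h₁.contDiffOn_S hT₁).add contDiffOn_const)).congr
    fun _ hx => flowConj_of_mem hx

lemma hasDerivWithinAt_flowConj (h₁ : FlowLine T₁ v₁ w₁ S₁) (h₂ : FlowLine T₂ v₂ w₂ S₂)
    {d₀ d₁ : ℝ} (hd₀ : Tendsto (fun t => v₂ (t + τ) / v₁ t) atBot (𝓝 d₀))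
    (hd₁ : Tendsto (fun t => v₂ (t + τ) / v₁ t) atTop (𝓝 d₁)) :
    ∃ D : ℝ → ℝ, ContinuousOn D (Icc 0 1) ∧ D 0 = d₀ ∧ D 1 = d₁ ∧
      (∀ x ∈ Ioo (0 : ℝ) 1, 0 < D x) ∧
      ∀ x ∈ Icc (0 : ℝ) 1, HasDerivWithinAt (flowConj S₁ T₂ τ) (D x) (Icc 0 1) x := by
  set q : ℝ → ℝ := fun t => v₂ (t + τ) / v₁ t with hq
  set D : ℝ → ℝ := fun x => if x ≤ 0 then d₀ else if 1 ≤ x then d₁ else q (S₁ x) with hD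
  have hD0 : D 0 = d₀ := by simp [hD]
  have hD1 : D 1 = d₁ := by simp [hD]
  have hDI : ∀ x ∈ Ioo (0 : ℝ) 1, D x = q (S₁ x) := fun x hx => by
    simp [hD, not_le.2 hx.1, not_le.2 hx.2]
  have hSd : ∀ x ∈ Ioo (0 : ℝ) 1, HasDerivAt S₁ (v₁ (S₁ x))⁻¹ x := fun x hx => by
    have := h₁.hasDerivAt_S (S₁ x)
    rwa [h₁.T_S x hx] at this
  have hd : ∀ x ∈ Ioo (0 : ℝ) 1, HasDerivAt (flowConj S₁ T₂ τ) (D x) x := by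
    intro x hx
    rw [hDI x hx]
    have h := (h₂.deriv_T (S₁ x + τ)).comp x ((hSd x hx).add_const τ)
    refine h.congr_of_eventuallyEq ?_
    filter_upwards [isOpen_Ioo.mem_nhds hx] with y hy using flowConj_of_mem hy
  have hqc : Continuous q := by
    have hc₁ := h₁.continuous_v
    have hc₂ := h₂.continuous_v
    exact (hc₂.comp (continuous_add_const τ)).div hc₁ fun t => (h₁.pos t).ne'
  have hDc : ∀ x ∈ Ioo (0 : ℝ) 1, ContinuousAt D x := fun x hx => by
    refine (hqc.continuousAt.comp (hSd x hx).continuousAt).congr ?_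
    filter_upwards [isOpen_Ioo.mem_nhds hx] with y hy using (hDI y hy).symm
  have hn0 : Ioo (0 : ℝ) 1 ∈ 𝓝[>] (0 : ℝ) := Ioo_mem_nhdsGT zero_lt_one
  have hn1 : Ioo (0 : ℝ) 1 ∈ 𝓝[<] (1 : ℝ) := Ioo_mem_nhdsLT zero_lt_one
  have hDlim0 : Tendsto D (𝓝[>] 0) (𝓝 d₀) := by
    refine (hd₀.comp h₁.tendsto_S_bot).congr' ?_
    filter_upwards [hn0] with x hx using (hDI x hx).symm
  have hDlim1 : Tendsto D (𝓝[<] 1) (𝓝 d₁) := by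
    refine (hd₁.comp h₁.tendsto_S_top).congr' ?_
    filter_upwards [hn1] with x hx using (hDI x hx).symm
  have hlim0 : Tendsto (flowConj S₁ T₂ τ) (𝓝[>] 0) (𝓝 0) := by
    refine ((h₂.T_bot.comp (tendsto_atBot_add_const_right _ τ h₁.tendsto_S_bot))).congr' ?_
    filter_upwards [hn0] with x hx using (flowConj_of_mem hx).symm
  have hlim1 : Tendsto (flowConj S₁ T₂ τ) (𝓝[<] 1) (𝓝 1) := by
    refine ((h₂.T_top.comp (tendsto_atTop_add_const_right _ τ h₁.tendsto_S_top))).congr' ?_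
    filter_upwards [hn1] with x hx using (flowConj_of_mem hx).symm
  have hdiff : DifferentiableOn ℝ (flowConj S₁ T₂ τ) (Ioo 0 1) := fun x hx =>
    (hd x hx).differentiableAt.differentiableWithinAt
  have hle0 : 𝓝[Ioo (0 : ℝ) 1] 0 ≤ 𝓝[>] 0 := nhdsWithin_mono _ fun x hx => hx.1
  have hle1 : 𝓝[Ioo (0 : ℝ) 1] 1 ≤ 𝓝[<] 1 := nhdsWithin_mono _ fun x hx => hx.2
  have hci : ∀ (g : ℝ → ℝ), Tendsto g (𝓝[>] 0) (𝓝 (g 0)) → Tendsto g (𝓝[<] 1) (𝓝 (g 1)) →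
      (∀ x ∈ Ioo (0 : ℝ) 1, ContinuousAt g x) → ContinuousOn g (Icc 0 1) := by
    intro g hg0 hg1 hg x hx
    rcases hx.1.eq_or_lt with rfl | h0
    · exact (continuousWithinAt_Ioi_iff_Ici.1 hg0).mono fun y hy => hy.1
    rcases hx.2.eq_or_lt with rfl | h1
    · exact (continuousWithinAt_Iio_iff_Iic.1 hg1).mono fun y hy => hy.2
    · exact (hg x ⟨h0, h1⟩).continuousWithinAt
  refine ⟨D, hci D (by rwa [hD0]) (by rwa [hD1]) hDc, hD0, hD1, fun x hx => ?_, fun x hx => ?_⟩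
  · rw [hDI x hx]
    exact div_pos (h₂.pos _) (h₁.pos _)
  rcases hx.1.eq_or_lt with rfl | hx0
  · rw [hD0]
    refine (hasDerivWithinAt_Ici_of_tendsto_deriv hdiff ?_ hn0 ?_).mono fun y hy => hy.1
    · rw [ContinuousWithinAt, flowConj_zero]
      exact hlim0.mono_left hle0
    · refine hDlim0.congr' ?_
      filter_upwards [hn0] with y hy using (hd y hy).deriv.symm
  rcases hx.2.eq_or_lt with rfl | hx1
  · rw [hD1]
    refine (hasDerivWithinAt_Iic_of_tendsto_deriv hdiff ?_ hn1 ?_).mono fun y hy => hy.2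
    · rw [ContinuousWithinAt, flowConj_one]
      exact hlim1.mono_left hle1
    · refine hDlim1.congr' ?_
      filter_upwards [hn1] with y hy using (hd y hy).deriv.symm
  · exact (hd x ⟨hx0, hx1⟩).hasDerivWithinAt

lemma contDiffOn_flowConj (h₁ : FlowLine T₁ v₁ w₁ S₁) (h₂ : FlowLine T₂ v₂ w₂ S₂)
    (hbot : ∃ d > 0, Tendsto (fun t => v₂ (t + τ) / v₁ t) atBot (𝓝 d))
    (htop : ∃ d > 0, Tendsto (fun t => v₂ (t + τ) / v₁ t) atTop (𝓝 d)) :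
    ContDiffOn ℝ 1 (flowConj S₁ T₂ τ) (Icc 0 1) ∧
      ∀ x ∈ Icc (0 : ℝ) 1, 0 < derivWithin (flowConj S₁ T₂ τ) (Icc 0 1) x := by
  obtain ⟨d₀, hd₀, hlim₀⟩ := hbot
  obtain ⟨d₁, hd₁, hlim₁⟩ := htop
  obtain ⟨D, hDc, rfl, rfl, hDpos, hD⟩ := h₁.hasDerivWithinAt_flowConj h₂ hlim₀ hlim₁
  have hu : UniqueDiffOn ℝ (Icc (0 : ℝ) 1) := uniqueDiffOn_Icc zero_lt_one
  have he : ∀ x ∈ Icc (0 : ℝ) 1, derivWithin (flowConj S₁ T₂ τ) (Icc 0 1) x = D x :=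
    fun x hx => (hD x hx).derivWithin (hu x hx)
  refine ⟨(contDiffOn_one_iff_derivWithin hu).2
    ⟨fun x hx => (hD x hx).differentiableWithinAt, hDc.congr he⟩, fun x hx => ?_⟩
  rw [he x hx]
  rcases hx.1.eq_or_lt with rfl | hx0
  · exact hd₀
  rcases hx.2.eq_or_lt with rfl | hx1
  · exact hd₁
  · exact hDpos x ⟨hx0, hx1⟩

lemma tendsto_ratio_symm {F : Filter ℝ} (hF : ∀ s, Tendsto (fun t : ℝ => t + s) F F)
    (h : ∃ d > 0, Tendsto (fun t => v₂ (t + τ) / v₁ t) F (𝓝 d)) :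
    ∃ d > 0, Tendsto (fun t => v₁ (t + -τ) / v₂ t) F (𝓝 d) := by
  obtain ⟨d, hd, hlim⟩ := h
  refine ⟨d⁻¹, inv_pos.2 hd, ((hlim.comp (hF (-τ))).inv₀ hd.ne').congr fun t => ?_⟩
  simp

/-- The flow conjugacy as a `C¹` diffeomorphism of `[0,1]`. -/
lemma exists_diffIcc (h₁ : FlowLine T₁ v₁ w₁ S₁) (h₂ : FlowLine T₂ v₂ w₂ S₂)
    (hbot : ∃ d > 0, Tendsto (fun t => v₂ (t + τ) / v₁ t) atBot (𝓝 d))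
    (htop : ∃ d > 0, Tendsto (fun t => v₂ (t + τ) / v₁ t) atTop (𝓝 d)) :
    ∃ φ : DiffIcc 1, φ.toFun = flowConj S₁ T₂ τ := by
  obtain ⟨hc, hp⟩ := h₁.contDiffOn_flowConj h₂ hbot htop
  obtain ⟨hc', -⟩ := h₂.contDiffOn_flowConj h₁
    (tendsto_ratio_symm (fun s => tendsto_atBot_add_const_right _ s tendsto_id) hbot)
    (tendsto_ratio_symm (fun s => tendsto_atTop_add_const_right _ s tendsto_id) htop)
  exact ⟨{
    toFun := flowConj S₁ T₂ τ
    invFun := flowConj S₂ T₁ (-τ)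
    smooth := by exact_mod_cast hc
    smooth_inv := by exact_mod_cast hc'
    maps := h₁.flowConj_mapsTo h₂
    maps_inv := h₂.flowConj_mapsTo h₁
    left_inv := fun x hx => h₁.flowConj_flowConj h₂ (by simp) hx
    right_inv := fun x hx => h₂.flowConj_flowConj h₁ (by simp) hx
    fix0 := flowConj_zero
    fix1 := flowConj_one
    deriv_pos := hp }, rfl⟩

lemma tendsto_ratio_shift {F : Filter ℝ} (hF : F = atTop ∨ F = atBot)
    (h₂ : FlowLine T₂ v₂ w₂ S₂) {τ' : ℝ}
    (h : ∃ d > 0, Tendsto (fun t => v₂ (t + τ) / v₁ t) F (𝓝 d)) :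
    ∃ d > 0, Tendsto (fun t => v₂ (t + τ') / v₁ t) F (𝓝 d) := by
  obtain ⟨d, hd, hlim⟩ := h
  obtain ⟨l, hl⟩ : ∃ l, Tendsto w₂ F (𝓝 l) := by
    rcases hF with rfl | rfl
    · exact h₂.w_top
    · exact h₂.w_bot
  have hs : Tendsto (fun t : ℝ => t + τ) F F := by
    rcases hF with rfl | rfl
    · exact tendsto_atTop_add_const_right _ τ tendsto_id
    · exact tendsto_atBot_add_const_right _ τ tendsto_id
  have hr := (h₂.tendsto_velocity_ratio hF hl (τ' - τ)).comp hs
  refine ⟨_, mul_pos (Real.exp_pos _) hd, (hr.mul hlim).congr fun t => ?_⟩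
  simp only [Function.comp, add_add_sub_cancel]
  exact div_mul_div_cancel₀ (h₂.pos _).ne'

lemma integral_inv (h : FlowLine T₁ v₁ w₁ S₁) {X : ℝ → ℝ} (hX : ContinuousOn X (Icc 0 1)) {ε : ℝ}
    (hε : ε * ε = 1) (hv : ∀ t, X (T₁ t) = ε * v₁ t) (s t : ℝ) :
    ∫ x in (T₁ s)..(T₁ t), (X x)⁻¹ = ε * (t - s) := by
  have hsub : uIcc (T₁ s) (T₁ t) ⊆ Ioo 0 1 := ordConnected_Ioo.uIcc_subset (h.mem s) (h.mem t)
  have hε0 : ε ≠ 0 := by rintro rfl; simp at hε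
  have hXne : ∀ x ∈ Ioo (0 : ℝ) 1, X x ≠ 0 := fun x hx => by
    rw [← h.T_S x hx, hv]
    exact mul_ne_zero hε0 (h.pos _).ne'
  rw [intervalIntegral.integral_eq_sub_of_hasDerivAt (f := fun x => ε * S₁ x)]
  · rw [h.S_T, h.S_T, mul_sub]
  · intro x hx
    have h1 := (h.hasDerivAt_S (S₁ x)).const_mul ε
    rw [h.T_S x (hsub hx)] at h1
    refine h1.congr_deriv ?_
    have h2 := hv (S₁ x)
    rw [h.T_S x (hsub hx)] at h2
    rw [h2, mul_inv]
    congr 1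
    field_simp
    linarith
  · refine ContinuousOn.intervalIntegrable ?_
    exact ((hX.mono (hsub.trans Ioo_subset_Icc_self)).inv₀ fun x hx => hXne x (hsub hx))

end FlowLine

namespace FlowLine

variable {T₁ v₁ w₁ S₁ T₂ v₂ w₂ S₂ : ℝ → ℝ}

/-- A local conjugacy advances the time coordinate by one when its argument does, and exists
only between maps moving points in the same direction. -/
lemma time_add_one (h₁ : FlowLine T₁ v₁ w₁ S₁) (h₂ : FlowLine T₂ v₂ w₂ S₂) {f g φ : ℝ → ℝ}
    {ε₁ ε₂ : ℝ} (hε₁ : ε₁ = 1 ∨ ε₁ = -1) (hε₂ : ε₂ = 1 ∨ ε₂ = -1)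
    (hf : ∀ t, f (T₁ t) = T₁ (t + ε₁)) (hg : ∀ t, g (T₂ t) = T₂ (t + ε₂)) {s : Set ℝ}
    (hmono : StrictMonoOn φ s) (hmaps : ∀ x ∈ s, x ∈ Ioo (0 : ℝ) 1 → φ x ∈ Ioo (0 : ℝ) 1)
    (hconj : ∀ x ∈ s, f x ∈ s → φ (f x) = g (φ x)) {t : ℝ} (ht : T₁ t ∈ s)
    (ht' : T₁ (t + 1) ∈ s) :
    ε₁ = ε₂ ∧ S₂ (φ (T₁ (t + 1))) = S₂ (φ (T₁ t)) + 1 := by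
  have hT : T₂ (S₂ (φ (T₁ t))) = φ (T₁ t) := h₂.T_S _ (hmaps _ ht (h₁.mem t))
  have hT' : T₂ (S₂ (φ (T₁ (t + 1)))) = φ (T₁ (t + 1)) := h₂.T_S _ (hmaps _ ht' (h₁.mem _))
  have hlt : S₂ (φ (T₁ t)) < S₂ (φ (T₁ (t + 1))) := by
    rw [← h₂.strictMono.lt_iff_lt, hT, hT']
    exact hmono ht ht' (h₁.strictMono (lt_add_one t))
  rcases hε₁ with rfl | rfl
  · have h := hconj _ ht (by rwa [hf])
    rw [hf, ← hT, ← hT', hg] at h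
    have h := h₂.strictMono.injective h
    rcases hε₂ with rfl | rfl
    · exact ⟨rfl, h⟩
    · linarith
  · have he : f (T₁ (t + 1)) = T₁ t := by rw [hf, add_neg_cancel_right]
    have h := hconj _ ht' (by rwa [he])
    rw [he, ← hT, ← hT', hg] at h
    have h := h₂.strictMono.injective h
    rcases hε₂ with rfl | rfl
    · linarith
    · exact ⟨rfl, by linarith⟩

/-- Two conjugacies which agree near `0` agree everywhere. -/
lemma eqOn_of_eventually_atBot (h₁ : FlowLine T₁ v₁ w₁ S₁) {f g : DiffIcc ⊤} {ε : ℝ}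
    (hε : ε = 1 ∨ ε = -1) (hf : ∀ t, f.toFun (T₁ t) = T₁ (t + ε)) {φ ψ : DiffIcc 1}
    (hφ : ∀ x ∈ Icc (0 : ℝ) 1, φ.toFun (f.toFun x) = g.toFun (φ.toFun x))
    (hψ : ∀ x ∈ Icc (0 : ℝ) 1, ψ.toFun (f.toFun x) = g.toFun (ψ.toFun x))
    (h : ∀ᶠ t in atBot, ψ.toFun (T₁ t) = φ.toFun (T₁ t)) :
    EqOn ψ.toFun φ.toFun (Icc 0 1) := by
  have hmem : ∀ t, T₁ t ∈ Icc (0 : ℝ) 1 := fun t => Ioo_subset_Icc_self (h₁.mem t)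
  have hstep : ∀ t, ψ.toFun (T₁ t) = φ.toFun (T₁ t) →
      ψ.toFun (T₁ (t + 1)) = φ.toFun (T₁ (t + 1)) := by
    intro t ht
    rcases hε with rfl | rfl
    · rw [← hf, hφ _ (hmem t), hψ _ (hmem t), ht]
    · have he : f.toFun (T₁ (t + 1)) = T₁ t := by rw [hf, add_neg_cancel_right]
      have h1 := hφ _ (hmem (t + 1))
      have h2 := hψ _ (hmem (t + 1))
      rw [he] at h1 h2
      rw [← g.left_inv _ (ψ.maps (hmem (t + 1))), ← h2, ht, h1,
        g.left_inv _ (φ.maps (hmem (t + 1)))]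
  have hnat : ∀ (n : ℕ) (t : ℝ), ψ.toFun (T₁ t) = φ.toFun (T₁ t) →
      ψ.toFun (T₁ (t + n)) = φ.toFun (T₁ (t + n)) := by
    intro n t ht
    induction n with
    | zero => simpa using ht
    | succ n ih => simpa [add_assoc] using hstep _ ih
  intro x hx
  rcases h₁.exists_eq hx with rfl | rfl | ⟨t, rfl⟩
  · rw [ψ.fix0, φ.fix0]
  · rw [ψ.fix1, φ.fix1]
  · obtain ⟨t₀, ht₀⟩ := eventually_atBot.1 h
    obtain ⟨n, hn⟩ := exists_nat_ge (t - t₀)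
    simpa using hnat n (t - n) (ht₀ _ (by linarith))

end FlowLine

/-- Conjugacy criterion: local `C^1` conjugacies at the endpoints between two smooth
diffeomorphisms of `[0,1]` which embed in flows of `C^1` vector fields without interior
zeroes extend to a unique global `C^1` conjugacy agreeing with the given one near `0`;
this conjugacy is smooth in the interior and coincides near `1` with the local one
composed with an explicit flow map `φ_X^σ`. -/
theorem conjugacy_criterion
    (X Z : ℝ → ℝ)
    (hX1 : ContDiffOn ℝ 1 X (Set.Icc 0 1)) (hZ1 : ContDiffOn ℝ 1 Z (Set.Icc 0 1))
    (hXzero : ∀ x ∈ Set.Icc (0:ℝ) 1, (X x = 0 ↔ x = 0 ∨ x = 1))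
    (hZzero : ∀ x ∈ Set.Icc (0:ℝ) 1, (Z x = 0 ↔ x = 0 ∨ x = 1))
    (ΦX ΦZ : ℝ → ℝ → ℝ)
    (hΦX0 : ∀ x ∈ Set.Icc (0:ℝ) 1, ΦX 0 x = x)
    (hΦX : ∀ x ∈ Set.Icc (0:ℝ) 1, ∀ t : ℝ,
      ΦX t x ∈ Set.Icc (0:ℝ) 1 ∧ HasDerivAt (fun s => ΦX s x) (X (ΦX t x)) t)
    (hΦXadd : ∀ s t : ℝ, ∀ x ∈ Set.Icc (0:ℝ) 1, ΦX (s + t) x = ΦX s (ΦX t x))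
    (hΦZ0 : ∀ x ∈ Set.Icc (0:ℝ) 1, ΦZ 0 x = x)
    (hΦZ : ∀ x ∈ Set.Icc (0:ℝ) 1, ∀ t : ℝ,
      ΦZ t x ∈ Set.Icc (0:ℝ) 1 ∧ HasDerivAt (fun s => ΦZ s x) (Z (ΦZ t x)) t)
    (f g : DiffIcc ⊤)
    (hfX : ∀ x ∈ Set.Icc (0:ℝ) 1, f.toFun x = ΦX 1 x)
    (hgZ : ∀ x ∈ Set.Icc (0:ℝ) 1, g.toFun x = ΦZ 1 x)
    (φ₀ : ℝ → ℝ) (a : ℝ) (ha : 0 < a) (ha' : a ≤ 1)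
    (hφ₀sm : ContDiffOn ℝ 1 φ₀ (Set.Icc 0 a)) (hφ₀0 : φ₀ 0 = 0)
    (hφ₀maps : Set.MapsTo φ₀ (Set.Icc 0 a) (Set.Icc 0 1))
    (hφ₀mono : StrictMonoOn φ₀ (Set.Icc 0 a))
    (hφ₀deriv : ∀ x ∈ Set.Icc (0:ℝ) a, 0 < derivWithin φ₀ (Set.Icc 0 a) x)
    (hφ₀conj : ∀ x ∈ Set.Icc (0:ℝ) a, f.toFun x ∈ Set.Icc (0:ℝ) a →
      φ₀ (f.toFun x) = g.toFun (φ₀ x))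
    (φ₁ : ℝ → ℝ) (b : ℝ) (hb : 0 < b) (hb' : b ≤ 1)
    (hφ₁sm : ContDiffOn ℝ 1 φ₁ (Set.Icc (1 - b) 1)) (hφ₁1 : φ₁ 1 = 1)
    (hφ₁maps : Set.MapsTo φ₁ (Set.Icc (1 - b) 1) (Set.Icc 0 1))
    (hφ₁mono : StrictMonoOn φ₁ (Set.Icc (1 - b) 1))
    (hφ₁deriv : ∀ x ∈ Set.Icc (1 - b) (1:ℝ), 0 < derivWithin φ₁ (Set.Icc (1 - b) 1) x)
    (hφ₁conj : ∀ x ∈ Set.Icc (1 - b) (1:ℝ), f.toFun x ∈ Set.Icc (1 - b) (1:ℝ) →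
      φ₁ (f.toFun x) = g.toFun (φ₁ x)) :
    ∃ (φ : DiffIcc 1) (σ : ℝ),
      (∃ c > (0:ℝ), ∀ x ∈ Set.Icc (0:ℝ) c, φ.toFun x = φ₀ x) ∧
      (∀ x ∈ Set.Icc (0:ℝ) 1, φ.toFun (f.toFun x) = g.toFun (φ.toFun x)) ∧
      ContDiffOn ℝ (⊤ : ℕ∞) φ.toFun (Set.Ioo 0 1) ∧
      (∃ c > (0:ℝ), ∀ x ∈ Set.Icc (1 - c) (1:ℝ), φ.toFun x = φ₁ (ΦX σ x)) ∧
      (∃ c > (0:ℝ), ∀ x₀ ∈ Set.Ioc (0:ℝ) c, ∀ x₁ ∈ Set.Ico (1 - c) (1:ℝ),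
        σ = (∫ x in x₀..x₁, (X x)⁻¹) - ∫ x in (φ₀ x₀)..(φ₁ x₁), (Z x)⁻¹) ∧
      (∀ ψ : DiffIcc 1,
        (∃ c > (0:ℝ), ∀ x ∈ Set.Icc (0:ℝ) c, ψ.toFun x = φ₀ x) →
        (∀ x ∈ Set.Icc (0:ℝ) 1, ψ.toFun (f.toFun x) = g.toFun (ψ.toFun x)) →
        ∀ x ∈ Set.Icc (0:ℝ) 1, ψ.toFun x = φ.toFun x) := by
  obtain ⟨T₁, v₁, w₁, S₁, ε, h₁, hT₁, hε, hv₁, hΦ₁, hΦ₁'⟩ :=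
    exists_flowLine hX1 hXzero hΦX0 hΦX hfX
  obtain ⟨T₂, v₂, w₂, S₂, ε', h₂, hT₂, hε', hv₂, hΦ₂, -⟩ :=
    exists_flowLine hZ1 hZzero hΦZ0 hΦZ hgZ
  have hm₁ : ∀ t, T₁ t ∈ Icc (0 : ℝ) 1 := fun t => Ioo_subset_Icc_self (h₁.mem t)
  have hm₂ : ∀ t, T₂ t ∈ Icc (0 : ℝ) 1 := fun t => Ioo_subset_Icc_self (h₂.mem t)
  have hf : ∀ t, f.toFun (T₁ t) = T₁ (t + ε) := fun t => by rw [hfX _ (hm₁ t), hΦ₁, mul_one]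
  have hg : ∀ t, g.toFun (T₂ t) = T₂ (t + ε') := fun t => by rw [hgZ _ (hm₂ t), hΦ₂, mul_one]
  have hφ₀I : ∀ x ∈ Ico 0 a, x ∈ Ioo (0 : ℝ) 1 → φ₀ x ∈ Ioo (0 : ℝ) 1 := fun x hx hx' => by
    have hxa := Ico_subset_Icc_self hx
    have haa : a ∈ Icc 0 a := ⟨ha.le, le_rfl⟩
    exact ⟨hφ₀0 ▸ hφ₀mono ⟨le_rfl, ha.le⟩ hxa hx'.1,
      (hφ₀mono hxa haa hx.2).trans_le (hφ₀maps haa).2⟩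
  have hφ₁I : ∀ x ∈ Ioc (1 - b) 1, x ∈ Ioo (0 : ℝ) 1 → φ₁ x ∈ Ioo (0 : ℝ) 1 := fun x hx hx' => by
    have hxb := Ioc_subset_Icc_self hx
    have hbb : 1 - b ∈ Icc (1 - b) 1 := ⟨le_rfl, by linarith⟩
    exact ⟨(hφ₁maps hbb).1.trans_lt (hφ₁mono hbb hxb hx.1),
      hφ₁1 ▸ hφ₁mono hxb ⟨by linarith, le_rfl⟩ hx'.2⟩
  have hstep₀ : ∀ t, T₁ t < a → ε = ε' ∧ S₂ (φ₀ (T₁ (t - 1))) = S₂ (φ₀ (T₁ t)) - 1 := by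
    intro t ht
    have hlt : T₁ (t - 1) < T₁ t := h₁.strictMono (sub_one_lt t)
    have h := h₁.time_add_one h₂ hε hε' hf hg (s := Ico 0 a) (t := t - 1)
      (hφ₀mono.mono Ico_subset_Icc_self) hφ₀I
      (fun x hx hx' => hφ₀conj x (Ico_subset_Icc_self hx) (Ico_subset_Icc_self hx'))
      ⟨(hm₁ _).1, hlt.trans ht⟩ (by rw [sub_add_cancel]; exact ⟨(hm₁ _).1, ht⟩)
    rw [sub_add_cancel] at h
    exact ⟨h.1, by linarith [h.2]⟩
  have hstep₁ : ∀ t, 1 - b < T₁ t → S₂ (φ₁ (T₁ (t + 1))) = S₂ (φ₁ (T₁ t)) + 1 := fun t ht =>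
    (h₁.time_add_one h₂ hε hε' hf hg (s := Ioc (1 - b) 1)
      (hφ₁mono.mono Ioc_subset_Icc_self) hφ₁I
      (fun x hx hx' => hφ₁conj x (Ioc_subset_Icc_self hx) (Ioc_subset_Icc_self hx'))
      ⟨ht, (hm₁ _).2⟩ ⟨ht.trans (h₁.strictMono (lt_add_one t)), (hm₁ _).2⟩).2
  obtain rfl : ε = ε' := by
    obtain ⟨t, ht⟩ := (h₁.T_bot.eventually (gt_mem_nhds ha)).exists
    exact (hstep₀ t ht).1
  have hεε : ε * ε = 1 := by rcases hε with rfl | rfl <;> norm_num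
  obtain ⟨τ₀, hτ₀, hlim₀⟩ := h₁.exists_shift_bot h₂ ha hφ₀sm hφ₀0 hφ₀maps hφ₀mono hφ₀deriv
    fun t ht => (hstep₀ t ht).2
  obtain ⟨τ₁, hτ₁, hlim₁⟩ := h₁.exists_shift_top h₂ hb hφ₁sm hφ₁1 hφ₁maps hφ₁mono hφ₁deriv hstep₁
  obtain ⟨φ, hφ⟩ := h₁.exists_diffIcc h₂ hlim₀ (FlowLine.tendsto_ratio_shift (Or.inl rfl) h₂ hlim₁)
  have hφT : ∀ t, φ.toFun (T₁ t) = T₂ (t + τ₀) := fun t => by rw [hφ, h₁.flowConj_apply]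
  have hφf : ∀ x ∈ Icc (0 : ℝ) 1, φ.toFun (f.toFun x) = g.toFun (φ.toFun x) := by
    intro x hx
    rcases h₁.exists_eq hx with rfl | rfl | ⟨t, rfl⟩
    · rw [f.fix0, φ.fix0, g.fix0]
    · rw [f.fix1, φ.fix1, g.fix1]
    · rw [hf, hφT, hφT, hg, add_right_comm]
  obtain ⟨t₀, ht₀⟩ := eventually_atBot.1 hτ₀
  obtain ⟨t₁, ht₁⟩ := eventually_atTop.1 (hτ₁.and
    ((tendsto_atTop_add_const_right _ (τ₀ - τ₁) tendsto_id).eventually hτ₁))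
  have hlow : ∀ x ∈ Ioc 0 (T₁ t₀), ∃ t ≤ t₀, x = T₁ t := fun x hx => by
    have he := h₁.T_S x ⟨hx.1, hx.2.trans_lt (h₁.mem t₀).2⟩
    exact ⟨S₁ x, h₁.strictMono.le_iff_le.1 (he.trans_le hx.2), he.symm⟩
  have hhigh : ∀ x ∈ Ico (T₁ t₁) 1, ∃ t ≥ t₁, x = T₁ t := fun x hx => by
    have he := h₁.T_S x ⟨(h₁.mem t₁).1.trans_le hx.1, hx.2⟩
    exact ⟨S₁ x, h₁.strictMono.le_iff_le.1 (hx.1.trans_eq he.symm), he.symm⟩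
  refine ⟨φ, ε * (τ₀ - τ₁), ⟨T₁ t₀, (h₁.mem t₀).1, fun x hx => ?_⟩, hφf, ?_,
    ⟨1 - T₁ t₁, sub_pos.2 (h₁.mem t₁).2, fun x hx => ?_⟩,
    ⟨min (T₁ t₀) (1 - T₁ t₁), lt_min (h₁.mem t₀).1 (sub_pos.2 (h₁.mem t₁).2),
      fun x₀ hx₀ x₁ hx₁ => ?_⟩, ?_⟩
  · rcases hx.1.eq_or_lt with rfl | hx0
    · rw [φ.fix0, hφ₀0]
    obtain ⟨t, ht, rfl⟩ := hlow x ⟨hx0, hx.2⟩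
    rw [hφT, ht₀ t ht]
  · rw [hφ]
    exact h₁.contDiffOn_flowConj_Ioo hT₁ hT₂
  · rw [sub_sub_cancel] at hx
    rcases hx.2.eq_or_lt with rfl | hx1
    · rw [φ.fix1, hΦ₁', hφ₁1]
    obtain ⟨t, ht, rfl⟩ := hhigh x ⟨hx.1, hx1⟩
    have h := (ht₁ t ht).2
    simp only [id] at h
    rw [hφT, hΦ₁, ← mul_assoc, hεε, one_mul, h]
    congr 1
    ring
  · obtain ⟨s₀, hs₀, rfl⟩ := hlow x₀ ⟨hx₀.1, hx₀.2.trans (min_le_left _ _)⟩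
    obtain ⟨s₁, hs₁, rfl⟩ := hhigh x₁
      ⟨by linarith [hx₁.1, min_le_right (T₁ t₀) (1 - T₁ t₁)], hx₁.2⟩
    rw [ht₀ s₀ hs₀, (ht₁ s₁ hs₁).1, h₁.integral_inv hX1.continuousOn hεε hv₁,
      h₂.integral_inv hZ1.continuousOn hεε hv₂]
    ring
  · rintro ψ ⟨c, hc, hψ₀⟩ hψ x hx
    refine h₁.eqOn_of_eventually_atBot hε hf hφf hψ ?_ hx
    filter_upwards [h₁.T_bot.eventually (gt_mem_nhds hc), hτ₀] with t ht ht'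
    rw [hψ₀ _ ⟨(hm₁ t).1, ht.le⟩, hφT, ht']
end
end
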